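/- arXiv:2309.10921 — 3 statements merged into one kernel-verified Lean document; each statement's English description precedes it below -/
import Mathlib

section
/- Fix an integer ℓ ≥ 2, a vector 𝐦 = (𝐦_S) of nonnegative integers indexed by unordered pairs of distinct elements of [ℓ], and constants C0 > 0 and c > 0. There exists an integer N such that for every n ≥ N the following holds. Let 𝓕_1,…,𝓕_ℓ be an extremal 𝐦-overlapping tuple of families of subsets of [n], let C*_k = {x ∈ [n] : d_k(x) ≥ 1/2 − C0/n}, and let k0 ∈ [ℓ] be such that for every k ≠ k0 one has |{F ∈ 𝓕_k : F ∩ C*_{k0} ≠ ∅}| ≤ e^{−c·n}·|𝓕_k| (i.e. k0 is a source). Suppose moreover that there exist indices k1 ≠ k0 and k2 ≠ k1 with 𝐦_{k1,k2} > 0. Then C*_{k0} = ∅. -/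
open scoped Classical

noncomputable section

/-- The `𝐦`-overlapping property. -/
def Overlap {n ℓ : ℕ} (m : Fin ℓ → Fin ℓ → ℕ) (F : Fin ℓ → Finset (Finset (Fin n))) : Prop :=
  ∀ k1 k2 : Fin ℓ, k1 ≠ k2 → ∀ A ∈ F k1, ∀ B ∈ F k2, (A ∩ B).card ≤ m k1 k2

/-- An `𝐦`-overlapping tuple maximizing the product of cardinalities. -/
def Extremal {n ℓ : ℕ} (m : Fin ℓ → Fin ℓ → ℕ) (F : Fin ℓ → Finset (Finset (Fin n))) : Prop :=
  Overlap m F ∧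
    ∀ G : Fin ℓ → Finset (Finset (Fin n)), Overlap m G →
      ∏ k, (G k).card ≤ ∏ k, (F k).card

/-- The normalized degree `d_k(S) = |{F ∈ 𝓕_k : S ⊆ F}| / |𝓕_k|`. -/
def deg {n ℓ : ℕ} (F : Fin ℓ → Finset (Finset (Fin n))) (k : Fin ℓ) (S : Finset (Fin n)) : ℝ :=
  (((F k).filter (fun A => S ⊆ A)).card : ℝ) / ((F k).card : ℝ)

/-- The set `{x ∈ [n] : d_k(x) ≥ 1/2 − α}` (a probabilistic center). -/
def center {n ℓ : ℕ} (F : Fin ℓ → Finset (Finset (Fin n))) (α : ℝ) (k : Fin ℓ) :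
    Finset (Fin n) :=
  Finset.univ.filter (fun x => (1 : ℝ) / 2 - α ≤ deg F k {x})

variable {n ℓ : ℕ} {m : Fin ℓ → Fin ℓ → ℕ} {F : Fin ℓ → Finset (Finset (Fin n))}

/-- An extremal tuple consists of nonempty families. -/
theorem Extremal.card_pos (hF : Extremal m F) (k : Fin ℓ) : 0 < (F k).card := by
  have h := hF.2 (fun _ => {∅}) (by intro k1 k2 _ A hA B hB; simp_all)
  simp only [Finset.card_singleton, Finset.prod_const_one] at h
  rw [Nat.pos_iff_ne_zero]
  intro h0
  rw [Finset.prod_eq_zero (Finset.mem_univ k) h0] at h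
  omega

/-- The families of an extremal tuple are closed under taking subsets. -/
theorem Extremal.mem_of_subset (hF : Extremal m F) {k : Fin ℓ} {A B : Finset (Fin n)}
    (hA : A ∈ F k) (hBA : B ⊆ A) : B ∈ F k := by
  by_contra hB
  let G : Fin ℓ → Finset (Finset (Fin n)) := fun j => if j = k then insert B (F k) else F j
  have hGF : ∀ j, ∀ X ∈ G j, ∃ Y ∈ F j, X ⊆ Y := by
    intro j X hX
    by_cases hj : j = k
    · subst hj
      simp only [G, if_true, Finset.mem_insert] at hX
      rcases hX with rfl | hX
      · exact ⟨A, hA, hBA⟩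
      · exact ⟨X, hX, subset_rfl⟩
    · simp only [G, if_neg hj] at hX
      exact ⟨X, hX, subset_rfl⟩
  have hG : Overlap m G := by
    intro k1 k2 hk X hX Y hY
    obtain ⟨X', hX', hXX⟩ := hGF k1 X hX
    obtain ⟨Y', hY', hYY⟩ := hGF k2 Y hY
    exact (Finset.card_le_card (Finset.inter_subset_inter hXX hYY)).trans
      (hF.1 k1 k2 hk X' hX' Y' hY')
  refine absurd (hF.2 G hG) (not_le.mpr ?_)
  refine Finset.prod_lt_prod (fun j _ => hF.card_pos j) (fun j _ => ?_) ⟨k, Finset.mem_univ k, ?_⟩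
  · by_cases hj : j = k
    · subst hj
      simp [G, Finset.card_insert_of_notMem hB]
    · simp [G, hj]
  · simp [G, Finset.card_insert_of_notMem hB]

/-- Adjoining a new element `x` to subfamilies whose overlaps leave room for it preserves
the overlapping property. -/
theorem Overlap.union_image_insert {K E : Fin ℓ → Finset (Finset (Fin n))} (hK : Overlap m K)
    {x : Fin n} (hxK : ∀ j, ∀ A ∈ K j, x ∉ A) (hEK : ∀ j, ∀ A ∈ E j, ∃ B ∈ K j, A ⊆ B)
    (hE : ∀ i j, i ≠ j → ∀ A ∈ E i, ∀ B ∈ E j, (A ∩ B).card + 1 ≤ m i j) :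
    Overlap m (fun j => K j ∪ (E j).image (insert x)) := by
  intro i j hij A hA B hB
  simp only [Finset.mem_union, Finset.mem_image] at hA hB
  rcases hA with hA | ⟨A, hA, rfl⟩ <;> rcases hB with hB | ⟨B, hB, rfl⟩
  · exact hK i j hij A hA B hB
  · obtain ⟨B', hB', hBB⟩ := hEK j B hB
    rw [Finset.inter_insert_of_notMem (hxK i A hA)]
    exact (Finset.card_le_card (Finset.inter_subset_inter subset_rfl hBB)).trans
      (hK i j hij A hA B' hB')
  · obtain ⟨A', hA', hAA⟩ := hEK i A hA
    rw [Finset.insert_inter_of_notMem (hxK j B hB)]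
    exact (Finset.card_le_card (Finset.inter_subset_inter hAA subset_rfl)).trans
      (hK i j hij A' hA' B hB)
  · rw [← Finset.insert_inter_distrib]
    exact (Finset.card_insert_le _ _).trans (hE i j hij A hA B hB)

theorem card_union_image_insert {K E : Finset (Finset (Fin n))} {x : Fin n}
    (hxK : ∀ A ∈ K, x ∉ A) (hxE : ∀ A ∈ E, x ∉ A) :
    (K ∪ E.image (insert x)).card = K.card + E.card := by
  rw [Finset.card_union_of_disjoint, Finset.card_image_of_injOn]
  · intro A hA B hB h
    rw [← Finset.erase_insert (hxE A hA), ← Finset.erase_insert (hxE B hB)]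
    exact congrArg (fun S => S.erase x) h
  · rw [Finset.disjoint_left]
    intro A hA hA'
    obtain ⟨B, -, rfl⟩ := Finset.mem_image.mp hA'
    exact hxK _ hA (Finset.mem_insert_self x B)

/-- Adding an unused element freely to one family doubles the product. -/
theorem Overlap.exists_double {K : Fin ℓ → Finset (Finset (Fin n))} (hK : Overlap m K)
    {x : Fin n} (hxK : ∀ j, ∀ A ∈ K j, x ∉ A) (k : Fin ℓ) :
    ∃ H : Fin ℓ → Finset (Finset (Fin n)), Overlap m H ∧
      ∏ j, (H j).card = 2 * ∏ j, (K j).card ∧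
      ∀ j, ∀ A ∈ H j, ∃ B ∈ K j, A ⊆ insert x B := by
  have hxE : ∀ j, ∀ A ∈ (if j = k then K j else ∅), x ∉ A := by
    intro j A hA
    split_ifs at hA
    · exact hxK j A hA
    · simp at hA
  refine ⟨fun j => K j ∪ (if j = k then K j else ∅).image (insert x),
    hK.union_image_insert hxK (E := fun j => if j = k then K j else ∅) ?_ ?_, ?_, ?_⟩
  · intro j A hA
    split_ifs at hA
    · exact ⟨A, hA, subset_rfl⟩
    · simp at hA
  · intro i j hij A hA B hB
    split_ifs at hA hB <;> simp_all
  · have h : ∀ j, (K j ∪ (if j = k then K j else ∅).image (insert x)).card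
        = (if j = k then 2 else 1) * (K j).card := by
      intro j
      rw [card_union_image_insert (hxK j) (hxE j)]
      split_ifs <;> simp [two_mul]
    simp only [h, Finset.prod_mul_distrib, Finset.prod_ite_eq', Finset.mem_univ, if_true]
  · intro j A hA
    rcases Finset.mem_union.mp hA with hA | hA
    · exact ⟨A, hA, Finset.subset_insert _ _⟩
    · obtain ⟨B, hB, rfl⟩ := Finset.mem_image.mp hA
      split_ifs at hB
      · exact ⟨B, hB, subset_rfl⟩
      · simp at hB

/-- Adjoining to an overlapping tuple an unused element `x` that imitates `y`. -/
theorem Overlap.exists_imitate {K : Fin ℓ → Finset (Finset (Fin n))} (hK : Overlap m K)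
    {x y : Fin n} (hxK : ∀ j, ∀ A ∈ K j, x ∉ A) (k : Fin ℓ) :
    ∃ H : Fin ℓ → Finset (Finset (Fin n)), Overlap m H ∧
      ∀ j, (H j).card = (K j).card +
        (if j = k then 2 else 1) * ((K j).filter (fun A => y ∈ A)).card := by
  let L : Fin ℓ → Finset (Finset (Fin n)) := fun j =>
    ((K j).filter (fun A => y ∈ A)).image (fun A => A.erase y)
  let E : Fin ℓ → Finset (Finset (Fin n)) := fun j =>
    L j ∪ (if j = k then L j else ∅).image (insert y)
  have hL : ∀ j, ∀ A ∈ L j, y ∉ A ∧ insert y A ∈ K j := by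
    intro j A hA
    obtain ⟨B, hB, rfl⟩ := Finset.mem_image.mp hA
    obtain ⟨hB, hyB⟩ := Finset.mem_filter.mp hB
    exact ⟨Finset.notMem_erase y B, by rwa [Finset.insert_erase hyB]⟩
  have hLc : ∀ j, (L j).card = ((K j).filter (fun A => y ∈ A)).card := by
    intro j
    refine Finset.card_image_of_injOn fun A hA B hB h => ?_
    rw [← Finset.insert_erase (Finset.mem_filter.mp hA).2,
      ← Finset.insert_erase (Finset.mem_filter.mp hB).2]
    exact congrArg (insert y) h
  have hE : ∀ j, ∀ A ∈ E j, insert y A ∈ K j ∧ (j ≠ k → y ∉ A) := by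
    intro j A hA
    rcases Finset.mem_union.mp hA with hA | hA
    · exact ⟨(hL j A hA).2, fun _ => (hL j A hA).1⟩
    · obtain ⟨B, hB, rfl⟩ := Finset.mem_image.mp hA
      split_ifs at hB with hj
      · exact ⟨by simpa using (hL j B hB).2, fun h => absurd hj h⟩
      · simp at hB
  have hxE : ∀ j, ∀ A ∈ E j, x ∉ A := fun j A hA h =>
    hxK j _ (hE j A hA).1 (Finset.mem_insert_of_mem h)
  refine ⟨fun j => K j ∪ (E j).image (insert x), hK.union_image_insert hxK ?_ ?_, fun j => ?_⟩
  · exact fun j A hA => ⟨_, (hE j A hA).1, Finset.subset_insert _ _⟩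
  · intro i j hij A hA B hB
    have hy : y ∉ A ∩ B := by
      rw [Finset.mem_inter]
      rintro ⟨h1, h2⟩
      by_cases hi : i = k
      · exact (hE j B hB).2 (fun h => hij (hi.trans h.symm)) h2
      · exact (hE i A hA).2 hi h1
    rw [← Finset.card_insert_of_notMem hy, Finset.insert_inter_distrib]
    exact hK i j hij _ (hE i A hA).1 _ (hE j B hB).1
  · rw [card_union_image_insert (hxK j) (hxE j), card_union_image_insert (fun A hA => (hL j A hA).1)]
    · split_ifs <;> simp [hLc, two_mul]
    · intro A hA
      split_ifs at hA
      · exact (hL j A hA).1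
      · simp at hA

/-- In a family closed under removing `x`, at most half of the members contain `x`. -/
theorem card_filter_mem_le {K : Finset (Finset (Fin n))} {x : Fin n}
    (hK : ∀ A ∈ K, A.erase x ∈ K) :
    (K.filter (fun A => x ∈ A)).card ≤ (K.filter (fun A => x ∉ A)).card := by
  refine Finset.card_le_card_of_injOn (fun A => A.erase x) (fun A hA => ?_) fun A hA B hB h => ?_
  · simp only [Finset.coe_filter, Set.mem_ofPred_eq] at hA ⊢
    exact ⟨hK A hA.1, Finset.notMem_erase x A⟩
  · rw [← Finset.insert_erase (Finset.mem_filter.mp hA).2,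
      ← Finset.insert_erase (Finset.mem_filter.mp hB).2]
    exact congrArg (insert x) h

/-- The Weierstrass product inequality. -/
theorem one_sub_sum_le_prod_one_sub {ι : Type*} (s : Finset ι) (f : ι → ℝ)
    (h0 : ∀ i ∈ s, 0 ≤ f i) (h1 : ∀ i ∈ s, f i ≤ 1) :
    1 - ∑ i ∈ s, f i ≤ ∏ i ∈ s, (1 - f i) := by
  induction s using Finset.induction_on with
  | empty => simp
  | insert a s ha ih =>
    rw [Finset.sum_insert ha, Finset.prod_insert ha]
    have h := ih (fun i hi => h0 i (Finset.mem_insert_of_mem hi))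
      (fun i hi => h1 i (Finset.mem_insert_of_mem hi))
    have ha0 := h0 a (Finset.mem_insert_self a s)
    have ha1 := h1 a (Finset.mem_insert_self a s)
    have hs : 0 ≤ ∑ i ∈ s, f i :=
      Finset.sum_nonneg fun i hi => h0 i (Finset.mem_insert_of_mem hi)
    nlinarith [mul_le_mul_of_nonneg_left h (sub_nonneg.mpr ha1), mul_nonneg ha0 hs]

theorem one_add_sum_le_prod_one_add {ι : Type*} (s : Finset ι) (f : ι → ℝ)
    (h0 : ∀ i ∈ s, 0 ≤ f i) : 1 + ∑ i ∈ s, f i ≤ ∏ i ∈ s, (1 + f i) := by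
  induction s using Finset.induction_on with
  | empty => simp
  | insert a s ha ih =>
    rw [Finset.sum_insert ha, Finset.prod_insert ha]
    have h := ih (fun i hi => h0 i (Finset.mem_insert_of_mem hi))
    have ha0 := h0 a (Finset.mem_insert_self a s)
    have hs : 0 ≤ ∑ i ∈ s, f i :=
      Finset.sum_nonneg fun i hi => h0 i (Finset.mem_insert_of_mem hi)
    nlinarith [mul_le_mul_of_nonneg_left h (show 0 ≤ 1 + f a by linarith), mul_nonneg ha0 hs]

/-- If the products of `1 - d j` and of `1 + d j` (with one factor boosted to `1 + 2 * d k`) are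
almost at most `1 / 2` and `2`, then all but one of the `d j` are almost zero. -/
theorem exists_forall_ne_le_of_prod_le {d : Fin ℓ → ℝ} {e : ℝ} (hℓ : 1 ≤ ℓ) (he0 : 0 ≤ e)
    (he : e ≤ 1 / 2) (hd0 : ∀ j, 0 ≤ d j) (hd1 : ∀ j, d j ≤ 1 / 2)
    (hsub : ∏ j, (1 - d j) ≤ (1 + e) / 2)
    (hadd : ∀ k, ∏ j, (1 + (if j = k then 2 else 1) * d j) ≤ 2 * (1 + e)) :
    ∃ k, ∀ j, j ≠ k → d j ≤ 66 * ℓ ^ 2 * e := by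
  have hne : (Finset.univ : Finset (Fin ℓ)).Nonempty := ⟨⟨0, hℓ⟩, Finset.mem_univ _⟩
  obtain ⟨k, -, hk⟩ := Finset.exists_max_image Finset.univ d hne
  refine ⟨k, fun j hj => ?_⟩
  set s := Finset.univ.erase k with hs
  set a := d k with ha
  set σ := ∑ i ∈ s, d i with hσ
  have hjσ : d j ≤ σ := Finset.single_le_sum (fun i _ => hd0 i) (by simp [hs, hj])
  set P := ∏ i ∈ s, (1 + d i) with hP
  set Q := ∏ i ∈ s, (1 - d i) with hQ
  have hsub' : (1 - a) * Q ≤ (1 + e) / 2 := by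
    rw [ha, hQ, hs, Finset.mul_prod_erase _ (fun i => 1 - d i) (Finset.mem_univ k)]
    exact hsub
  have hadd' : (1 + 2 * a) * P ≤ 2 * (1 + e) := by
    have h := hadd k
    rw [← Finset.mul_prod_erase _ _ (Finset.mem_univ k), if_pos rfl] at h
    convert h using 2
    refine Finset.prod_congr rfl fun i hi => ?_
    rw [if_neg (Finset.ne_of_mem_erase hi), one_mul]
  have hPσ : 1 + σ ≤ P := one_add_sum_le_prod_one_add s d fun i _ => hd0 i
  have hQ0 : 0 ≤ Q := Finset.prod_nonneg fun i _ => by linarith [hd1 i]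
  have ha0 : 0 ≤ a := hd0 k
  have ha1 : a ≤ 1 / 2 := hd1 k
  have hσ0 : 0 ≤ σ := Finset.sum_nonneg fun i _ => hd0 i
  have hPQ : 1 - a * σ ≤ P * Q := by
    rw [hP, hQ, ← Finset.prod_mul_distrib]
    calc 1 - a * σ ≤ 1 - ∑ i ∈ s, d i ^ 2 := by
          rw [hσ, Finset.mul_sum]
          refine sub_le_sub_left (Finset.sum_le_sum fun i _ => ?_) _
          rw [sq]
          exact mul_le_mul_of_nonneg_right (hk i (Finset.mem_univ i)) (hd0 i)
      _ ≤ ∏ i ∈ s, (1 - d i ^ 2) := one_sub_sum_le_prod_one_sub s _ (fun i _ => sq_nonneg _)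
          fun i _ => by nlinarith [hd0 i, hd1 i]
      _ = _ := Finset.prod_congr rfl fun i _ => by ring
  have hlow : 1 - ℓ * a ≤ (1 + e) / 2 := by
    refine le_trans ?_ ((one_sub_sum_le_prod_one_sub Finset.univ d (fun i _ => hd0 i)
      fun i _ => (hd1 i).trans (by norm_num)).trans hsub)
    have h := Finset.sum_le_card_nsmul Finset.univ d a hk
    simp only [Finset.card_univ, Fintype.card_fin, nsmul_eq_mul] at h
    linarith
  have hσ1 : (1 + 2 * a) * σ ≤ 1 - 2 * a + 2 * e := by
    nlinarith [mul_le_mul_of_nonneg_left hPσ (show 0 ≤ 1 + 2 * a by linarith)]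
  have hprod : (1 + 2 * a) * (1 - a) * (1 - a * σ) ≤ (1 + e) ^ 2 := by
    calc (1 + 2 * a) * (1 - a) * (1 - a * σ) ≤ (1 + 2 * a) * (1 - a) * (P * Q) :=
          mul_le_mul_of_nonneg_left hPQ (mul_nonneg (by linarith) (by linarith))
      _ = ((1 + 2 * a) * P) * ((1 - a) * Q) := by ring
      _ ≤ (2 * (1 + e)) * ((1 + e) / 2) :=
          mul_le_mul hadd' hsub' (mul_nonneg (by linarith) hQ0) (by linarith)
      _ = _ := by ring
  have hcub : a ^ 2 * (1 - 2 * a) ≤ 4 * e := by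
    have h1 := mul_le_mul_of_nonneg_left hσ1 (mul_nonneg ha0 (show 0 ≤ 1 - a by linarith))
    have h2 : a * (1 - a) * e ≤ 1 / 4 * e :=
      mul_le_mul_of_nonneg_right (by nlinarith [sq_nonneg (a - 1 / 2)]) he0
    nlinarith
  have hℓ' : (1 : ℝ) ≤ ℓ := by exact_mod_cast hℓ
  have hℓa : 1 ≤ 16 * ((ℓ : ℝ) * a) ^ 2 := by nlinarith
  have hgap : 1 - 2 * a ≤ 64 * ℓ ^ 2 * e := by
    calc 1 - 2 * a ≤ (16 * ((ℓ : ℝ) * a) ^ 2) * (1 - 2 * a) :=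
          le_mul_of_one_le_left (by linarith) hℓa
      _ = 16 * ℓ ^ 2 * (a ^ 2 * (1 - 2 * a)) := by ring
      _ ≤ 16 * ℓ ^ 2 * (4 * e) := mul_le_mul_of_nonneg_left hcub (by positivity)
      _ = _ := by ring
  have h2 : 2 * e ≤ 2 * ℓ ^ 2 * e :=
    mul_le_mul_of_nonneg_right (by nlinarith) he0
  nlinarith [mul_nonneg ha0 hσ0]

/-- If all degrees outside sets partitioning the ground set are at most `1 / (2 n)`, then the
product of the cardinalities is at most `2 ^ ℓ * 2 ^ n`. -/
theorem prod_card_le_of_degree_le {G : Fin ℓ → Finset (Finset (Fin n))} (κ : Fin n → Fin ℓ)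
    {τ : ℝ} (hτ : n * τ ≤ 1 / 2)
    (hκ : ∀ y j, j ≠ κ y → (((G j).filter (fun A => y ∈ A)).card : ℝ) ≤ τ * (G j).card) :
    ∏ j, (G j).card ≤ 2 ^ ℓ * 2 ^ n := by
  rcases Nat.eq_zero_or_pos n with rfl | hn
  · calc ∏ j, (G j).card ≤ ∏ _j : Fin ℓ, 1 :=
          Finset.prod_le_prod' fun j _ => by
            simpa using Finset.card_le_univ (G j)
      _ ≤ _ := by simpa using Nat.one_le_two_pow
  let C : Fin ℓ → Finset (Fin n) := fun j => Finset.univ.filter (fun y => κ y = j)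
  have hcard : ∀ j, (G j).card ≤ 2 * 2 ^ (C j).card := by
    intro j
    have hout : (((G j).filter (fun A => ¬ A ⊆ C j)).card : ℝ) ≤ (G j).card / 2 := by
      have hsub : (G j).filter (fun A => ¬ A ⊆ C j) ⊆
          (Finset.univ \ C j).biUnion (fun y => (G j).filter (fun A => y ∈ A)) := by
        intro A hA
        obtain ⟨hA, hAC⟩ := Finset.mem_filter.mp hA
        obtain ⟨y, hy, hyC⟩ := Finset.not_subset.mp hAC
        simp only [Finset.mem_biUnion, Finset.mem_filter]
        exact ⟨y, by simpa using hyC, hA, hy⟩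
      have h1 := (Finset.card_le_card hsub).trans Finset.card_biUnion_le
      calc (((G j).filter (fun A => ¬ A ⊆ C j)).card : ℝ)
          ≤ ∑ y ∈ Finset.univ \ C j, (((G j).filter (fun A => y ∈ A)).card : ℝ) := by
            exact_mod_cast h1
        _ ≤ ∑ y ∈ Finset.univ \ C j, 1 / (2 * n : ℝ) * (G j).card := by
            refine Finset.sum_le_sum fun y hy => (hκ y j ?_).trans ?_
            · simp only [C, Finset.mem_sdiff, Finset.mem_filter, Finset.mem_univ, true_and] at hy
              exact fun h => hy h.symm
            · refine mul_le_mul_of_nonneg_right ?_ (Nat.cast_nonneg _)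
              have hn' : (0 : ℝ) < n := by exact_mod_cast hn
              rw [le_div_iff₀ (by positivity)]
              linarith
        _ ≤ ∑ _y : Fin n, 1 / (2 * n : ℝ) * (G j).card :=
            Finset.sum_le_sum_of_subset_of_nonneg (Finset.subset_univ _)
              fun _ _ _ => by positivity
        _ = (G j).card / 2 := by
            have hn' : (n : ℝ) ≠ 0 := by exact_mod_cast hn.ne'
            simp only [Finset.sum_const, Finset.card_univ, Fintype.card_fin, nsmul_eq_mul]
            field_simp
    have hin : ((G j).filter (fun A => A ⊆ C j)).card ≤ 2 ^ (C j).card := by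
      rw [← Finset.card_powerset]
      exact Finset.card_le_card fun A hA => by simpa using (Finset.mem_filter.mp hA).2
    have hsplit := Finset.card_filter_add_card_filter_not (s := G j) (fun A => A ⊆ C j)
    have hout' : 2 * ((G j).filter (fun A => ¬ A ⊆ C j)).card ≤ (G j).card := by
      have : 2 * (((G j).filter (fun A => ¬ A ⊆ C j)).card : ℝ) ≤ (G j).card := by linarith
      exact_mod_cast this
    omega
  have hsum : ∑ j, (C j).card = n := by
    have h := Finset.card_eq_sum_card_fiberwise (f := κ) (s := Finset.univ) (t := Finset.univ)
      (fun _ _ => Finset.mem_coe.mpr (Finset.mem_univ _))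
    simpa using h.symm
  calc ∏ j, (G j).card ≤ ∏ j, (2 * 2 ^ (C j).card) := Finset.prod_le_prod' fun j _ => hcard j
    _ = 2 ^ ℓ * 2 ^ n := by
      rw [Finset.prod_mul_distrib, Finset.prod_pow_eq_pow_sum, hsum]
      simp

/-- If some overlap is allowed, the extremal product is at least `n * 2 ^ n`. -/
theorem Extremal.mul_two_pow_le (hF : Extremal m F) (hsym : ∀ k1 k2, m k1 k2 = m k2 k1)
    {k1 k2 : Fin ℓ} (hk : k2 ≠ k1) (hm : 0 < m k1 k2) : n * 2 ^ n ≤ ∏ k, (F k).card := by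
  let G : Fin ℓ → Finset (Finset (Fin n)) := fun j =>
    if j = k1 then Finset.univ else if j = k2 then Finset.univ.image singleton else {∅}
  have hG1 : ∀ j, j ≠ k1 → ∀ A ∈ G j, A.card ≤ 1 ∧ (j ≠ k2 → A.card = 0) := by
    intro j hj A hA
    simp only [G, if_neg hj] at hA
    split_ifs at hA with h
    · obtain ⟨a, -, rfl⟩ := Finset.mem_image.mp hA
      simp [h]
    · simp_all
  have hG : Overlap m G := by
    intro i j hij A hA B hB
    have hl := Finset.card_le_card (Finset.inter_subset_left (s₁ := A) (s₂ := B))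
    have hr := Finset.card_le_card (Finset.inter_subset_right (s₁ := A) (s₂ := B))
    by_cases hi : i = k1
    · subst hi
      have h := hG1 j hij.symm B hB
      by_cases hj : j = k2
      · subst hj; omega
      · have := h.2 hj; omega
    · have h := hG1 i hi A hA
      by_cases hi2 : i = k2
      · subst hi2
        by_cases hj : j = k1
        · subst hj
          have := hsym i j
          omega
        · have h' := (hG1 j hj B hB).2 hij.symm
          omega
      · have := h.2 hi2; omega
  refine le_trans (le_of_eq ?_) (hF.2 G hG)
  have h : ∀ j, (G j).card = (if j = k1 then 2 ^ n else 1) * (if j = k2 then n else 1) := by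
    intro j
    by_cases h1 : j = k1
    · subst h1
      simp [G, hk.symm]
    · by_cases h2 : j = k2
      · subst h2
        simp [G, h1, Finset.card_image_of_injective _ Finset.singleton_injective]
      · simp [G, h1, h2]
  simp only [h, Finset.prod_mul_distrib, Finset.prod_ite_eq', Finset.mem_univ, if_true]
  exact mul_comm _ _

/-- In an extremal tuple on a large ground set, restricting to the members avoiding a point `x`
decreases the product by a factor noticeably larger than `2`. -/
theorem Extremal.two_mul_prod_card_filter_lt (hF : Extremal m F)
    (hsym : ∀ k1 k2, m k1 k2 = m k2 k1) {k1 k2 : Fin ℓ} (hk : k2 ≠ k1) (hm : 0 < m k1 k2)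
    (hn : 2 ^ (ℓ + 2) < n) {e : ℝ} (he0 : 0 ≤ e) (he : e ≤ 1 / 2)
    (hne : n * (66 * ℓ ^ 2 * e) ≤ 1 / 2) (x : Fin n) :
    2 * (1 + e) * ∏ k, (((F k).filter (fun A => x ∉ A)).card : ℝ) < ∏ k, ((F k).card : ℝ) := by
  by_contra! hle
  set G : Fin ℓ → Finset (Finset (Fin n)) := fun k => (F k).filter (fun A => x ∉ A) with hGdef
  have hxG : ∀ j, ∀ A ∈ G j, x ∉ A := fun j A hA => (Finset.mem_filter.mp hA).2
  have hG : Overlap m G := fun i j hij A hA B hB =>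
    hF.1 i j hij A (Finset.mem_filter.mp hA).1 B (Finset.mem_filter.mp hB).1
  have hGpos : ∀ j, (0 : ℝ) < (G j).card := by
    intro j
    obtain ⟨A, hA⟩ := Finset.card_pos.mp (hF.card_pos j)
    have : ∅ ∈ G j :=
      Finset.mem_filter.mpr ⟨hF.mem_of_subset hA (Finset.empty_subset A), by simp⟩
    exact_mod_cast Finset.card_pos.mpr ⟨_, this⟩
  have hGprod : (0 : ℝ) < ∏ j, ((G j).card : ℝ) := Finset.prod_pos fun j _ => hGpos j
  have hmax : ∀ H : Fin ℓ → Finset (Finset (Fin n)), Overlap m H →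
      ∏ j, ((H j).card : ℝ) ≤ 2 * (1 + e) * ∏ j, ((G j).card : ℝ) := fun H hH =>
    le_trans (by exact_mod_cast hF.2 H hH) hle
  have hcenter : ∀ y, ∃ k, ∀ j, j ≠ k →
      (((G j).filter (fun A => y ∈ A)).card : ℝ) ≤ 66 * ℓ ^ 2 * e * (G j).card := by
    intro y
    by_cases hxy : x = y
    · subst hxy
      refine ⟨k1, fun j _ => ?_⟩
      rw [Finset.filter_false_of_mem (hxG j), Finset.card_empty, Nat.cast_zero]
      positivity
    let d : Fin ℓ → ℝ := fun j => ((G j).filter (fun A => y ∈ A)).card / (G j).card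
    have hd : ∀ j, (((G j).filter (fun A => y ∈ A)).card : ℝ) = d j * (G j).card :=
      fun j => (div_mul_cancel₀ _ (hGpos j).ne').symm
    have hsplit : ∀ j, (((G j).filter (fun A => y ∈ A)).card : ℝ) +
        ((G j).filter (fun A => y ∉ A)).card = (G j).card := fun j => by
      exact_mod_cast Finset.card_filter_add_card_filter_not (s := G j) (fun A => y ∈ A)
    have hd' : ∀ j, (((G j).filter (fun A => y ∉ A)).card : ℝ) = (1 - d j) * (G j).card :=
      fun j => by linarith [hsplit j, hd j]
    have hhalf : ∀ j, d j ≤ 1 / 2 := by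
      intro j
      have h : ((G j).filter (fun A => y ∈ A)).card ≤ ((G j).filter (fun A => y ∉ A)).card := by
        refine card_filter_mem_le fun A hA => ?_
        obtain ⟨hA, hxA⟩ := Finset.mem_filter.mp hA
        exact Finset.mem_filter.mpr ⟨hF.mem_of_subset hA (Finset.erase_subset y A),
          fun h => hxA (Finset.mem_of_mem_erase h)⟩
      have h' : (((G j).filter (fun A => y ∈ A)).card : ℝ) ≤
        ((G j).filter (fun A => y ∉ A)).card := by exact_mod_cast h
      rw [div_le_iff₀ (hGpos j)]
      linarith [hsplit j]
    have hsub : ∏ j, (1 - d j) ≤ (1 + e) / 2 := by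
      let K : Fin ℓ → Finset (Finset (Fin n)) := fun j => (G j).filter (fun A => y ∉ A)
      have hK : Overlap m K := fun i j hij A hA B hB =>
        hG i j hij A (Finset.mem_filter.mp hA).1 B (Finset.mem_filter.mp hB).1
      obtain ⟨H, hH, hHc, hHK⟩ := hK.exists_double (x := x)
        (fun j A hA => hxG j A (Finset.mem_filter.mp hA).1) k1
      obtain ⟨H', hH', hHc', -⟩ := hH.exists_double (x := y) (fun j A hA h => by
        obtain ⟨B, hB, hAB⟩ := hHK j A hA
        rcases Finset.mem_insert.mp (hAB h) with h | h
        · exact hxy h.symm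
        · exact (Finset.mem_filter.mp hB).2 h) k1
      have h := hmax H' hH'
      have hc : ∏ j, ((H' j).card : ℝ) = 4 * ∏ j, ((K j).card : ℝ) := by
        have : ∏ j, (H' j).card = 4 * ∏ j, (K j).card := by rw [hHc', hHc]; ring
        exact_mod_cast this
      have hKc : ∏ j, ((K j).card : ℝ) = (∏ j, (1 - d j)) * ∏ j, ((G j).card : ℝ) := by
        rw [← Finset.prod_mul_distrib]
        exact Finset.prod_congr rfl fun j _ => hd' j
      rw [hc, hKc] at h
      refine le_of_mul_le_mul_right ?_ hGprod
      linarith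
    have hadd : ∀ k, ∏ j, (1 + (if j = k then 2 else 1) * d j) ≤ 2 * (1 + e) := by
      intro k
      obtain ⟨H, hH, hHc⟩ := hG.exists_imitate (y := y) hxG k
      have h := hmax H hH
      have hc : ∏ j, ((H j).card : ℝ) =
          (∏ j, (1 + (if j = k then 2 else 1) * d j)) * ∏ j, ((G j).card : ℝ) := by
        rw [← Finset.prod_mul_distrib]
        refine Finset.prod_congr rfl fun j _ => ?_
        rw [hHc]
        push_cast
        rw [hd]
        ring
      rw [hc] at h
      exact le_of_mul_le_mul_right h hGprod
    obtain ⟨k, hk⟩ := exists_forall_ne_le_of_prod_le (Fin.pos k1) he0 he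
      (fun j => div_nonneg (Nat.cast_nonneg _) (Nat.cast_nonneg _)) hhalf hsub hadd
    refine ⟨k, fun j hj => ?_⟩
    rw [hd]
    exact mul_le_mul_of_nonneg_right (hk j hj) (Nat.cast_nonneg _)
  choose κ hκ using hcenter
  have hup := prod_card_le_of_degree_le κ hne hκ
  have hlow := hF.mul_two_pow_le hsym hk hm
  have hup' : ∏ j, ((G j).card : ℝ) ≤ 2 ^ ℓ * 2 ^ n := by exact_mod_cast hup
  have hlow' : (n : ℝ) * 2 ^ n ≤ ∏ k, ((F k).card : ℝ) := by exact_mod_cast hlow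
  have hn' : (2 : ℝ) ^ (ℓ + 2) < n := by exact_mod_cast hn
  have h1 : 2 * (1 + e) * ∏ j, ((G j).card : ℝ) ≤ 4 * (2 ^ ℓ * 2 ^ n) :=
    mul_le_mul (by linarith) hup' hGprod.le (by norm_num)
  have h2 : (2 : ℝ) ^ (ℓ + 2) * 2 ^ n < n * 2 ^ n := mul_lt_mul_of_pos_right hn' (by positivity)
  have h3 : (2 : ℝ) ^ (ℓ + 2) * 2 ^ n = 4 * (2 ^ ℓ * 2 ^ n) := by ring
  linarith

/-- If all families but one contain few members through `x`, then restricting to the members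
avoiding `x` decreases the product by a factor of at most about `2`. -/
theorem Extremal.prod_card_le_two_mul (hF : Extremal m F) {ε : ℝ} (hε0 : 0 ≤ ε) (hε1 : ε ≤ 1)
    (hε : ℓ * ε ≤ 1 / 2) (x : Fin n) (k0 : Fin ℓ)
    (hx : ∀ k, k ≠ k0 → (((F k).filter (fun A => x ∈ A)).card : ℝ) ≤ ε * (F k).card) :
    ∏ k, ((F k).card : ℝ) ≤
      2 * (1 + 2 * ℓ * ε) * ∏ k, (((F k).filter (fun A => x ∉ A)).card : ℝ) := by
  have hsplit : ∀ j, (((F j).filter (fun A => x ∈ A)).card : ℝ) +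
      ((F j).filter (fun A => x ∉ A)).card = (F j).card := fun j => by
    exact_mod_cast Finset.card_filter_add_card_filter_not (s := F j) (fun A => x ∈ A)
  have hfac : ∀ j, (1 - ε) * ((F j).card : ℝ) ≤
      (if j = k0 then 2 else 1) * ((F j).filter (fun A => x ∉ A)).card := by
    intro j
    split_ifs with hj
    · have h : (((F j).filter (fun A => x ∈ A)).card : ℝ) ≤
          ((F j).filter (fun A => x ∉ A)).card := by
        exact_mod_cast card_filter_mem_le fun A hA =>
          hF.mem_of_subset hA (Finset.erase_subset x A)
      have h0 : 0 ≤ ε * ((F j).card : ℝ) := by positivity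
      linarith [hsplit j]
    · linarith [hsplit j, hx j hj]
  have hprod := Finset.prod_le_prod (s := Finset.univ)
    (fun j _ => mul_nonneg (sub_nonneg.mpr hε1) (Nat.cast_nonneg (F j).card)) fun j _ => hfac j
  simp only [Finset.prod_mul_distrib, Finset.prod_ite_eq', Finset.mem_univ, if_true,
    Finset.prod_const, Finset.card_univ, Fintype.card_fin] at hprod
  have hbern : 1 - ℓ * ε ≤ (1 - ε) ^ ℓ := by
    have h := one_add_mul_le_pow (show (-2 : ℝ) ≤ -ε by linarith) ℓ
    rw [← sub_eq_add_neg] at h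
    linarith
  set S := ∏ k, ((F k).card : ℝ)
  have hS : 0 ≤ S := Finset.prod_nonneg fun _ _ => Nat.cast_nonneg _
  have hℓε : 0 ≤ ℓ * ε := by positivity
  have h1 : (1 - ℓ * ε) * S ≤
      2 * ∏ k, (((F k).filter (fun A => x ∉ A)).card : ℝ) :=
    (mul_le_mul_of_nonneg_right hbern hS).trans hprod
  calc S ≤ ((1 + 2 * ℓ * ε) * (1 - ℓ * ε)) * S := le_mul_of_one_le_left hS (by nlinarith)
    _ = (1 + 2 * ℓ * ε) * ((1 - ℓ * ε) * S) := by ring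
    _ ≤ (1 + 2 * ℓ * ε) * (2 * ∏ k, (((F k).filter (fun A => x ∉ A)).card : ℝ)) :=
        mul_le_mul_of_nonneg_left h1 (by linarith)
    _ = _ := by ring

/-- sources have empty centers, Proposition 17 of the paper.
Fix `ℓ ≥ 2`, symmetric `𝐦`, and constants `C0, c > 0`. There is `N` such that for all
`n ≥ N`, every extremal tuple `𝓕` with centers `C*_k = {x : d_k(x) ≥ 1/2 − C0/n}`, and
every source `k0` (i.e. `|{F ∈ 𝓕_k : F ∩ C*_{k0} ≠ ∅}| ≤ e^{−cn}|𝓕_k|` for all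
`k ≠ k0`), if there are `k1 ≠ k0` and `k2 ≠ k1` with `𝐦_{k1,k2} > 0`, then
`C*_{k0} = ∅`. -/
theorem source_empty_center (ℓ : ℕ) (hℓ : 2 ≤ ℓ) (m : Fin ℓ → Fin ℓ → ℕ)
    (hsym : ∀ k1 k2, m k1 k2 = m k2 k1) (C0 c : ℝ) (hC0 : 0 < C0) (hc : 0 < c) :
    ∃ N : ℕ, ∀ n : ℕ, N ≤ n →
      ∀ F : Fin ℓ → Finset (Finset (Fin n)), Extremal m F →
        ∀ k0 : Fin ℓ,
          (∀ k : Fin ℓ, k ≠ k0 →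
            (((F k).filter (fun A => (A ∩ center F (C0 / n) k0).Nonempty)).card : ℝ) ≤
              Real.exp (-c * n) * ((F k).card : ℝ)) →
          (∃ k1 k2 : Fin ℓ, k1 ≠ k0 ∧ k2 ≠ k1 ∧ 0 < m k1 k2) →
          center F (C0 / n) k0 = ∅ := by
  have hlim : Filter.Tendsto (fun n : ℕ => (n : ℝ) * Real.exp (-c * n)) Filter.atTop (nhds 0) := by
    have h := (Real.tendsto_pow_mul_exp_neg_atTop_nhds_zero 1).comp
      (tendsto_natCast_atTop_atTop.const_mul_atTop hc)
    have h' := h.const_mul c⁻¹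
    rw [mul_zero] at h'
    refine h'.congr fun n => ?_
    simp only [Function.comp_apply, pow_one, neg_mul]
    field_simp
  have hℓ' : (0 : ℝ) < ℓ := by exact_mod_cast (show 0 < ℓ by omega)
  have hδ : (0 : ℝ) < 1 / (264 * ℓ ^ 3) := by positivity
  obtain ⟨N, hN⟩ := Filter.eventually_atTop.mp (hlim.eventually (gt_mem_nhds hδ))
  refine ⟨max N (2 ^ (ℓ + 2) + 1), fun n hn F hF k0 hsrc ⟨k1, k2, _, hk, hm⟩ => ?_⟩
  have hnN := hN n ((le_max_left _ _).trans hn)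
  have hn2 : 2 ^ (ℓ + 2) < n := (le_max_right _ _).trans hn
  set ε := Real.exp (-c * n) with hεdef
  have hε0 : 0 ≤ ε := (Real.exp_pos _).le
  have hε1 : ε ≤ 1 := Real.exp_le_one_iff.mpr (by nlinarith [Nat.cast_nonneg (α := ℝ) n])
  have hsmall : 264 * (ℓ : ℝ) ^ 3 * (n * ε) ≤ 1 := by
    rw [lt_div_iff₀ (by positivity)] at hnN
    linarith
  have hℓ1 : (1 : ℝ) ≤ ℓ := by exact_mod_cast (show 1 ≤ ℓ by omega)
  have hn1 : (1 : ℝ) ≤ n := by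
    exact_mod_cast (Nat.one_le_two_pow.trans hn2.le)
  have hε : 4 * (ℓ * ε) ≤ 1 := by
    have h1 : (ℓ : ℝ) ≤ ℓ ^ 3 := le_self_pow₀ hℓ1 (by norm_num)
    have h2 : ε ≤ n * ε := le_mul_of_one_le_left hε0 hn1
    have h3 : ℓ * ε ≤ ℓ ^ 3 * (n * ε) := mul_le_mul h1 h2 hε0 (by positivity)
    have h4 : 0 ≤ (ℓ : ℝ) ^ 3 * (n * ε) := by positivity
    linarith
  rw [Finset.eq_empty_iff_forall_notMem]
  intro x hx
  have hub := hF.prod_card_le_two_mul hε0 hε1 (by linarith) x k0 fun k hk => by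
    refine le_trans ?_ (hsrc k hk)
    have h : ∀ A ∈ F k, x ∈ A → (A ∩ center F (C0 / n) k0).Nonempty := fun A _ hA =>
      ⟨x, Finset.mem_inter.mpr ⟨hA, hx⟩⟩
    exact_mod_cast Finset.card_le_card (Finset.monotone_filter_right _ h)
  have hlt := hF.two_mul_prod_card_filter_lt hsym hk hm hn2 (e := 2 * ℓ * ε) (by positivity)
    (by linarith) (by
      have h : (n : ℝ) * (66 * ℓ ^ 2 * (2 * ℓ * ε)) = 264 * (ℓ : ℝ) ^ 3 * (n * ε) / 2 := by ring
      linarith) x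
  exact absurd hub (not_le.mpr hlt)

end
end

section
/- Fix an integer ℓ ≥ 2 and a vector 𝐦 = (𝐦_S) of nonnegative integers indexed by unordered pairs of distinct elements of [ℓ]. There exist a constant C > 0 and an integer N such that for every n ≥ N and every extremal 𝐦-overlapping tuple 𝓕_1,…,𝓕_ℓ of families of subsets of [n] there exist subfamilies 𝓕'_k ⊆ 𝓕_k, k ∈ [ℓ], satisfying: (1) every element x ∈ [n] belongs to a member of at most two of the families 𝓕'_1,…,𝓕'_ℓ; (2) |𝓕'_k| ≥ (1 − C·n^{−1/2})·|𝓕_k| for every k ∈ [ℓ]. -/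
open scoped Classical

noncomputable section

open scoped FinsetFamily

/-- A family of subsets of `[n]` of size at most `r` has at most `(n + 1) ^ r` members. -/
theorem card_le_of_forall_card_le {n : ℕ} (r : ℕ) (U : Finset (Finset (Fin n)))
    (hU : ∀ A ∈ U, A.card ≤ r) : U.card ≤ (n + 1) ^ r := by
  induction r generalizing U with
  | zero =>
    have : U ⊆ {∅} := fun A hA => by simpa using hU A hA
    simpa using Finset.card_le_card this
  | succ r ih =>
    let V : Finset (Finset (Fin n)) := Finset.univ.filter (fun A => A.card ≤ r)
    have hV : V.card ≤ (n + 1) ^ r := ih V (by simp [V])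
    have hsub : U ⊆ ((Finset.univ : Finset (Option (Fin n))) ×ˢ V).image
        (fun p => p.1.elim p.2 (fun x => insert x p.2)) := by
      intro A hA
      rcases (hU A hA).lt_or_eq with h | h
      · exact Finset.mem_image.2 ⟨(none, A), by simp [V]; omega, rfl⟩
      · obtain ⟨x, hx⟩ : A.Nonempty := Finset.card_pos.1 (by omega)
        exact Finset.mem_image.2 ⟨(some x, A.erase x),
          by simp [V, Finset.card_erase_of_mem hx, h], by simp [Finset.insert_erase hx]⟩
    calc U.card ≤ _ := Finset.card_le_card hsub
      _ ≤ _ := Finset.card_image_le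
      _ = (n + 1) * V.card := by simp [Finset.card_product]
      _ ≤ (n + 1) * (n + 1) ^ r := Nat.mul_le_mul_left _ hV
      _ = (n + 1) ^ (r + 1) := by ring

/-- The sum of `m i j` over the pairs `i < j`. -/
def pairSum {ℓ : ℕ} (m : Fin ℓ → Fin ℓ → ℕ) : ℕ :=
  ∑ j, ∑ i, if i < j then m i j else 0

/-- Merging the families indexed by `s` one at a time by Daykin's inequality. -/
theorem exists_merged_family {n ℓ : ℕ} {m : Fin ℓ → Fin ℓ → ℕ}
    {F : Fin ℓ → Finset (Finset (Fin n))} (hF : Overlap m F) (s : Finset (Fin ℓ)) :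
    ∃ U : Finset (Finset (Fin n)),
      (∀ j ∉ s, ∀ B ∈ U, ∀ A ∈ F j, (B ∩ A).card ≤ ∑ k ∈ s, m k j) ∧
      ∏ k ∈ s, (F k).card ≤
        U.card * (n + 1) ^ (∑ j ∈ s, ∑ i ∈ s, if i < j then m i j else 0) := by
  induction s using Finset.induction_on_max with
  | empty => exact ⟨{∅}, by simp, by simp⟩
  | insert a s ha ih =>
    obtain ⟨U, hU, hcard⟩ := ih
    have has : a ∉ s := fun h => lt_irrefl _ (ha a h)
    refine ⟨U ⊻ F a, ?_, ?_⟩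
    · intro j hj B hB A hA
      simp only [Finset.mem_insert, not_or] at hj
      obtain ⟨B₁, hB₁, B₂, hB₂, rfl⟩ := Finset.mem_sups.1 hB
      rw [Finset.sum_insert has, Finset.sup_eq_union, Finset.union_inter_distrib_right]
      have h₁ := hU j hj.2 B₁ hB₁ A hA
      have h₂ := hF a j (Ne.symm hj.1) B₂ hB₂ A hA
      have h₃ := Finset.card_union_le (B₁ ∩ A) (B₂ ∩ A)
      omega
    · have hinf : (U ⊼ F a).card ≤ (n + 1) ^ (∑ k ∈ s, m k a) := by
        refine card_le_of_forall_card_le _ _ fun A hA => ?_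
        obtain ⟨B₁, hB₁, B₂, hB₂, rfl⟩ := Finset.mem_infs.1 hA
        exact hU a has B₁ hB₁ B₂ hB₂
      have hexp : (∑ j ∈ insert a s, ∑ i ∈ insert a s, if i < j then m i j else 0) =
          (∑ k ∈ s, m k a) + ∑ j ∈ s, ∑ i ∈ s, if i < j then m i j else 0 := by
        rw [Finset.sum_insert has, Finset.sum_insert has, if_neg (lt_irrefl a), zero_add]
        congr 1
        · exact Finset.sum_congr rfl fun i hi => if_pos (ha i hi)
        · refine Finset.sum_congr rfl fun j hj => ?_
          rw [Finset.sum_insert has, if_neg (ha j hj).not_gt, zero_add]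
      rw [Finset.prod_insert has, hexp, pow_add]
      generalize (n + 1) ^ (∑ j ∈ s, ∑ i ∈ s, if i < j then m i j else 0) = E at hcard ⊢
      calc (F a).card * ∏ k ∈ s, (F k).card
          ≤ (F a).card * (U.card * E) := Nat.mul_le_mul_left _ hcard
        _ = (U.card * (F a).card) * E := by ring
        _ ≤ ((U ⊼ F a).card * (U ⊻ F a).card) * E :=
          Nat.mul_le_mul_right _ (Finset.le_card_infs_mul_card_sups U (F a))
        _ ≤ ((n + 1) ^ (∑ k ∈ s, m k a) * (U ⊻ F a).card) * E :=
          Nat.mul_le_mul_right _ (Nat.mul_le_mul_right _ hinf)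
        _ = _ := by ring

/-- The upper bound `s*(n, ℓ, 𝐦) ≤ 2 ^ n (n + 1) ^ (∑ 𝐦_S)`. -/
theorem Overlap.prod_card_le {n ℓ : ℕ} {m : Fin ℓ → Fin ℓ → ℕ}
    {F : Fin ℓ → Finset (Finset (Fin n))} (hF : Overlap m F) :
    ∏ k, (F k).card ≤ 2 ^ n * (n + 1) ^ pairSum m := by
  obtain ⟨U, -, hU⟩ := exists_merged_family hF Finset.univ
  refine hU.trans (Nat.mul_le_mul_right _ ?_)
  simpa using Finset.card_le_univ U

/-- `X` carries an `m`-overlapping tuple of families with product of cardinalities at least `N`. -/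
def Carries {n ℓ : ℕ} (m : Fin ℓ → Fin ℓ → ℕ) (X : Finset (Fin n)) (N : ℕ) : Prop :=
  ∃ G : Fin ℓ → Finset (Finset (Fin n)),
    Overlap m G ∧ (∀ k, ∀ A ∈ G k, A ⊆ X) ∧ N ≤ ∏ k, (G k).card

theorem Carries.mono {n ℓ : ℕ} {m m' : Fin ℓ → Fin ℓ → ℕ} {X : Finset (Fin n)} {N : ℕ}
    (h : Carries m X N) (hm : ∀ i j, i ≠ j → m i j ≤ m' i j) : Carries m' X N := by
  obtain ⟨G, hG, hX, hN⟩ := h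
  exact ⟨G, fun i j hij A hA B hB => (hG i j hij A hA B hB).trans (hm i j hij), hX, hN⟩

theorem Carries.union {n ℓ : ℕ} {m₁ m₂ : Fin ℓ → Fin ℓ → ℕ} {X Y : Finset (Fin n)} {N₁ N₂ : ℕ}
    (h₁ : Carries m₁ X N₁) (h₂ : Carries m₂ Y N₂) (hXY : Disjoint X Y) :
    Carries (fun i j => m₁ i j + m₂ i j) (X ∪ Y) (N₁ * N₂) := by
  obtain ⟨G, hG, hGX, hGN⟩ := h₁
  obtain ⟨H, hH, hHY, hHN⟩ := h₂
  have hX : ∀ k, ∀ A ∈ G k, ∀ B ∈ H k, (A ∪ B) ∩ X = A := fun k A hA B hB => by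
    rw [Finset.union_inter_distrib_right, Finset.inter_eq_left.2 (hGX k A hA),
      Finset.disjoint_iff_inter_eq_empty.1 (hXY.symm.mono_left (hHY k B hB)), Finset.union_empty]
  have hY : ∀ k, ∀ A ∈ G k, ∀ B ∈ H k, (A ∪ B) ∩ Y = B := fun k A hA B hB => by
    rw [Finset.union_inter_distrib_right, Finset.inter_eq_left.2 (hHY k B hB),
      Finset.disjoint_iff_inter_eq_empty.1 (hXY.mono_left (hGX k A hA)), Finset.empty_union]
  refine ⟨fun k => G k ⊻ H k, ?_, ?_, ?_⟩
  · intro i j hij C hC D hD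
    obtain ⟨A, hA, B, hB, rfl⟩ := Finset.mem_sups.1 hC
    obtain ⟨A', hA', B', hB', rfl⟩ := Finset.mem_sups.1 hD
    have hsub : (A ⊔ B) ∩ (A' ⊔ B') ⊆ (A ∩ A') ∪ (B ∩ B') := by
      intro x hx
      simp only [Finset.sup_eq_union, Finset.mem_inter, Finset.mem_union] at hx ⊢
      have h := fun (hx₁ : x ∈ X) (hx₂ : x ∈ Y) => Finset.disjoint_left.1 hXY hx₁ hx₂
      have a₁ := @hGX i A hA x
      have a₂ := @hGX j A' hA' x
      have a₃ := @hHY i B hB x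
      have a₄ := @hHY j B' hB' x
      tauto
    exact (Finset.card_le_card hsub).trans <| (Finset.card_union_le _ _).trans <|
      add_le_add (hG i j hij A hA A' hA') (hH i j hij B hB B' hB')
  · intro k C hC
    obtain ⟨A, hA, B, hB, rfl⟩ := Finset.mem_sups.1 hC
    exact Finset.union_subset_union (hGX k A hA) (hHY k B hB)
  · have hcard : ∀ k, (G k ⊻ H k).card = (G k).card * (H k).card := fun k => by
      rw [Finset.card_sups_iff]
      rintro ⟨A, B⟩ hp ⟨A', B'⟩ hq heq
      simp only [Set.mem_prod, Finset.mem_coe, Finset.sup_eq_union] at hp hq heq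
      rw [Prod.mk.injEq]
      exact ⟨by rw [← hX k A hp.1 B hp.2, heq, hX k A' hq.1 B' hq.2],
        by rw [← hY k A hp.1 B hp.2, heq, hY k A' hq.1 B' hq.2]⟩
    simp only [hcard, Finset.prod_mul_distrib]
    exact Nat.mul_le_mul hGN hHN

/-- The overlap vector equal to `m p.1 p.2` at the pair `p` and zero elsewhere. -/
def singleOverlap {ℓ : ℕ} (m : Fin ℓ → Fin ℓ → ℕ) (p : Fin ℓ × Fin ℓ) (i j : Fin ℓ) : ℕ :=
  if (i, j) = p ∨ (j, i) = p then m p.1 p.2 else 0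

theorem carries_singleOverlap {n ℓ : ℕ} (m : Fin ℓ → Fin ℓ → ℕ) {p : Fin ℓ × Fin ℓ}
    (hp : p.1 ≠ p.2) (X : Finset (Fin n)) :
    Carries (singleOverlap m p) X (2 ^ X.card * X.card.choose (m p.1 p.2)) := by
  obtain ⟨a, b⟩ := p
  simp only at hp
  let G : Fin ℓ → Finset (Finset (Fin n)) := fun k =>
    if k = a then X.powerset else if k = b then X.powersetCard (m a b) else {∅}
  have hother : ∀ k, k ≠ a → k ≠ b → G k = {∅} := fun k h₁ h₂ => by simp [G, h₁, h₂]
  have ha : G a = X.powerset := by simp [G]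
  have hb : G b = X.powersetCard (m a b) := by simp [G, Ne.symm hp]
  refine ⟨G, ?_, ?_, ?_⟩
  · intro i j hij A hA B hB
    by_cases hi : i ≠ a ∧ i ≠ b
    · rw [hother i hi.1 hi.2, Finset.mem_singleton] at hA
      simp [hA]
    by_cases hj : j ≠ a ∧ j ≠ b
    · rw [hother j hj.1 hj.2, Finset.mem_singleton] at hB
      simp [hB]
    have : i = a ∧ j = b ∨ i = b ∧ j = a := by grind
    rcases this with ⟨rfl, rfl⟩ | ⟨rfl, rfl⟩
    · rw [hb, Finset.mem_powersetCard] at hB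
      simpa [singleOverlap, ← hB.2] using Finset.card_le_card Finset.inter_subset_right
    · rw [hb, Finset.mem_powersetCard] at hA
      simpa [singleOverlap, ← hA.2] using Finset.card_le_card Finset.inter_subset_left
  · intro k A hA
    by_cases hka : k = a
    · subst hka; simpa [ha] using hA
    by_cases hkb : k = b
    · subst hkb; rw [hb, Finset.mem_powersetCard] at hA; exact hA.1
    · rw [hother k hka hkb, Finset.mem_singleton] at hA; simp [hA]
  · have : ∏ k, (G k).card = ∏ k ∈ {a, b}, (G k).card := by
      refine (Finset.prod_subset (Finset.subset_univ _) fun k _ hk => ?_).symm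
      simp only [Finset.mem_insert, Finset.mem_singleton, not_or] at hk
      simp [hother k hk.1 hk.2]
    rw [this, Finset.prod_pair hp, ha, hb, Finset.card_powerset, Finset.card_powersetCard]

theorem carries_zero {n ℓ : ℕ} (k₀ : Fin ℓ) (X : Finset (Fin n)) :
    Carries (fun _ _ : Fin ℓ => 0) X (2 ^ X.card) := by
  refine ⟨fun k => if k = k₀ then X.powerset else {∅}, ?_, ?_, ?_⟩
  · intro i j hij A hA B hB
    by_cases hi : i = k₀
    · have hj : j ≠ k₀ := fun h => hij (hi.trans h.symm)
      simp only [if_neg hj, Finset.mem_singleton] at hB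
      simp [hB]
    · simp only [if_neg hi, Finset.mem_singleton] at hA
      simp [hA]
  · intro k A hA
    by_cases hk : k = k₀
    · simpa [hk] using hA
    · simp only [if_neg hk, Finset.mem_singleton] at hA
      simp [hA]
  · simp [apply_ite Finset.card]

theorem carries_sum_singleOverlap {n ℓ : ℕ} (k₀ : Fin ℓ) (m : Fin ℓ → Fin ℓ → ℕ) (q : ℕ)
    (s : Finset (Fin ℓ × Fin ℓ)) (hs : ∀ p ∈ s, p.1 < p.2) (X : Finset (Fin n))
    (hX : s.card * q ≤ X.card) :
    Carries (fun i j => ∑ p ∈ s, singleOverlap m p i j) X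
      (2 ^ X.card * ∏ p ∈ s, q.choose (m p.1 p.2)) := by
  induction s using Finset.induction_on generalizing X with
  | empty => simpa using carries_zero k₀ X
  | insert p s hps ih =>
    rw [Finset.card_insert_of_notMem hps, add_mul, one_mul] at hX
    obtain ⟨Y, hYX, hY⟩ := Finset.exists_subset_card_eq (s := X) (n := q) (by omega)
    have hcard : (X \ Y).card = X.card - q := by rw [Finset.card_sdiff_of_subset hYX, hY]
    have h₁ := carries_singleOverlap m (hs p (Finset.mem_insert_self p s)).ne Y
    have h₂ := ih (fun p' hp' => hs p' (Finset.mem_insert_of_mem hp')) (X \ Y) (by omega)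
    have h := h₁.union h₂ Finset.disjoint_sdiff
    rw [Finset.union_sdiff_of_subset hYX] at h
    simp only [Finset.sum_insert hps, Finset.prod_insert hps]
    have hpow : 2 ^ X.card = 2 ^ q * 2 ^ (X.card - q) := by
      rw [← pow_add]; congr 1; omega
    convert h using 1
    rw [hY, hcard, hpow]
    ring

theorem sum_singleOverlap_le {ℓ : ℕ} {m : Fin ℓ → Fin ℓ → ℕ} (hsym : ∀ i j, m i j = m j i)
    (i j : Fin ℓ) (hij : i ≠ j) :
    ∑ p ∈ Finset.univ.filter (fun p : Fin ℓ × Fin ℓ => p.1 < p.2), singleOverlap m p i j ≤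
      m i j := by
  wlog h : i < j generalizing i j
  · rw [hsym i j]
    refine le_trans (le_of_eq (Finset.sum_congr rfl fun p _ => ?_))
      (this j i hij.symm (lt_of_le_of_ne (not_lt.1 h) hij.symm))
    simp only [singleOverlap, or_comm]
  · rw [Finset.sum_eq_single (i, j)]
    · simp [singleOverlap]
    · rintro p hp hne
      have hlt := (Finset.mem_filter.1 hp).2
      refine if_neg ?_
      rintro (rfl | rfl)
      · exact hne rfl
      · exact lt_asymm h hlt
    · simp [h]

theorem eventually_le_choose_div (K t : ℕ) (hK : 0 < K) :
    ∃ c : ℝ, 0 < c ∧ ∀ᶠ n : ℕ in Filter.atTop, c * (n : ℝ) ^ t ≤ ((n / K).choose t : ℝ) := by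
  refine ⟨(1 / (2 * K)) ^ t / t.factorial, by positivity, ?_⟩
  filter_upwards [Filter.eventually_ge_atTop (2 * K * t)] with n hn
  refine le_trans ?_ (Nat.pow_le_choose t (n / K))
  rw [div_mul_eq_mul_div, ← mul_pow]
  gcongr
  have h₁ : n < K * (n / K + 1) := Nat.lt_mul_div_succ n hK
  have h₂ : t ≤ n / K := by
    rw [Nat.le_div_iff_mul_le hK]
    nlinarith
  have h₃ : ((n / K + 1 - t : ℕ) : ℝ) = ((n / K : ℕ) : ℝ) + 1 - t := by
    rw [Nat.cast_sub (by omega)]; push_cast; ring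
  have h₁' : (n : ℝ) < K * (((n / K : ℕ) : ℝ) + 1) := by exact_mod_cast h₁
  have hn' : 2 * (K : ℝ) * t ≤ n := by exact_mod_cast hn
  have hK' : (0 : ℝ) < K := by exact_mod_cast hK
  rw [h₃, one_div, ← div_eq_inv_mul, div_le_iff₀ (by positivity)]
  nlinarith

theorem pairSum_eq {ℓ : ℕ} (m : Fin ℓ → Fin ℓ → ℕ) :
    pairSum m = ∑ p ∈ Finset.univ.filter (fun p : Fin ℓ × Fin ℓ => p.1 < p.2), m p.1 p.2 := by
  rw [Finset.sum_filter, Fintype.sum_prod_type_right, pairSum]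

/-- The lower bound `s*(n, ℓ, 𝐦) ≥ c 2 ^ n n ^ (∑ 𝐦_S)`. -/
theorem exists_large_overlap {ℓ : ℕ} (k₀ : Fin ℓ) {m : Fin ℓ → Fin ℓ → ℕ}
    (hsym : ∀ i j, m i j = m j i) :
    ∃ c : ℝ, 0 < c ∧ ∀ᶠ n : ℕ in Filter.atTop, ∃ G : Fin ℓ → Finset (Finset (Fin n)),
      Overlap m G ∧ c * (2 ^ n * (n : ℝ) ^ pairSum m) ≤ ∏ k, ((G k).card : ℝ) := by
  set s := Finset.univ.filter (fun p : Fin ℓ × Fin ℓ => p.1 < p.2) with hs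
  choose c hc hev using fun t => eventually_le_choose_div (s.card + 1) t (by omega)
  refine ⟨∏ p ∈ s, c (m p.1 p.2), Finset.prod_pos fun p _ => hc _, ?_⟩
  filter_upwards [(Filter.eventually_all_finset s).2 fun p _ => hev (m p.1 p.2)] with n hn
  have hq : s.card * (n / (s.card + 1)) ≤ (Finset.univ : Finset (Fin n)).card := by
    rw [Finset.card_univ, Fintype.card_fin]
    refine le_trans (Nat.mul_le_mul_right _ (Nat.le_succ _)) (Nat.mul_div_le n _)
  obtain ⟨G, hG, -, hcard⟩ := (carries_sum_singleOverlap k₀ m (n / (s.card + 1)) s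
    (fun p hp => (Finset.mem_filter.1 hp).2) Finset.univ hq).mono (sum_singleOverlap_le hsym)
  refine ⟨G, hG, ?_⟩
  rw [Finset.card_univ, Fintype.card_fin] at hcard
  rw [pairSum_eq, ← Finset.prod_pow_eq_pow_sum, mul_left_comm, ← Finset.prod_mul_distrib]
  calc (2 : ℝ) ^ n * ∏ p ∈ s, c (m p.1 p.2) * (n : ℝ) ^ m p.1 p.2
      ≤ 2 ^ n * ∏ p ∈ s, ((n / (s.card + 1)).choose (m p.1 p.2) : ℝ) := by
        gcongr with p hp
        · exact fun p _ => mul_nonneg (hc _).le (by positivity)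
        · exact hn p hp
    _ ≤ _ := by exact_mod_cast hcard

/-- The members of `F k` containing `x` (if `k ∈ T`) or avoiding `x` (if `k ∉ T`), with `x`
removed. -/
def slice {n ℓ : ℕ} (F : Fin ℓ → Finset (Finset (Fin n))) (x : Fin n) (T : Finset (Fin ℓ))
    (k : Fin ℓ) : Finset (Finset (Fin n)) :=
  ((F k).filter (fun A => x ∈ A ↔ k ∈ T)).image (fun A => A.erase x)

section slice

variable {n ℓ : ℕ} {F : Fin ℓ → Finset (Finset (Fin n))} {x : Fin n} {T : Finset (Fin ℓ)}

theorem mem_slice {k : Fin ℓ} {A : Finset (Fin n)} :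
    A ∈ slice F x T k ↔ ∃ B ∈ F k, (x ∈ B ↔ k ∈ T) ∧ B.erase x = A := by
  simp [slice, and_assoc]

theorem card_slice (F : Fin ℓ → Finset (Finset (Fin n))) (x : Fin n) (T : Finset (Fin ℓ))
    (k : Fin ℓ) :
    (slice F x T k).card = ((F k).filter (fun A => x ∈ A ↔ k ∈ T)).card := by
  refine Finset.card_image_of_injOn fun A hA B hB hAB => ?_
  have hA := (Finset.mem_filter.1 hA).2
  have hB := (Finset.mem_filter.1 hB).2
  ext y
  by_cases hy : y = x
  · rw [hy, hA, hB]
  · have := congrArg (y ∈ ·) hAB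
    simpa [hy] using this

theorem Overlap.slice {m : Fin ℓ → Fin ℓ → ℕ} (hF : Overlap m F) (x : Fin n)
    (T : Finset (Fin ℓ)) :
    Overlap (fun i j => m i j - if i ∈ T ∧ j ∈ T then 1 else 0) (slice F x T) := by
  intro i j hij A hA B hB
  obtain ⟨A, hA', hAT, rfl⟩ := mem_slice.1 hA
  obtain ⟨B, hB', hBT, rfl⟩ := mem_slice.1 hB
  have h := hF i j hij A hA' B hB'
  have heq : A.erase x ∩ B.erase x = (A ∩ B).erase x := by ext; simp; tauto
  rw [heq]
  dsimp only
  split_ifs with hT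
  · rw [Finset.card_erase_of_mem (Finset.mem_inter.2 ⟨hAT.2 hT.1, hBT.2 hT.2⟩)]
    omega
  · exact (Finset.card_le_card (Finset.erase_subset _ _)).trans h

theorem Overlap.prod_card_slice_eq_zero {m : Fin ℓ → Fin ℓ → ℕ} (hF : Overlap m F) {i j : Fin ℓ}
    (hij : i ≠ j) (hi : i ∈ T) (hj : j ∈ T) (hm : m i j = 0) :
    ∏ k, (_root_.slice F x T k).card = 0 := by
  by_contra h
  rw [Finset.prod_eq_zero_iff] at h
  push Not at h
  obtain ⟨A, hA⟩ := Finset.card_ne_zero.1 (h i (Finset.mem_univ i))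
  obtain ⟨B, hB⟩ := Finset.card_ne_zero.1 (h j (Finset.mem_univ j))
  obtain ⟨A, hA', hAT, rfl⟩ := mem_slice.1 hA
  obtain ⟨B, hB', hBT, rfl⟩ := mem_slice.1 hB
  have h := hF i j hij A hA' B hB'
  rw [hm, Nat.le_zero, Finset.card_eq_zero] at h
  exact Finset.notMem_empty x (h ▸ Finset.mem_inter.2 ⟨hAT.2 hi, hBT.2 hj⟩)

end slice

/-- An element avoided by all families can be freely added to one of them. -/
theorem Extremal.two_mul_prod_card_le {n ℓ : ℕ} {m : Fin ℓ → Fin ℓ → ℕ}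
    {F G : Fin ℓ → Finset (Finset (Fin n))} (hF : Extremal m F) (hG : Overlap m G) {x : Fin n}
    (hx : ∀ k, ∀ A ∈ G k, x ∉ A) (k₀ : Fin ℓ) :
    2 * ∏ k, (G k).card ≤ ∏ k, (F k).card := by
  let H : Fin ℓ → Finset (Finset (Fin n)) := fun k =>
    if k = k₀ then G k ∪ (G k).image (insert x) else G k
  have hH : ∀ k, ∀ A ∈ H k, A.erase x ∈ G k ∧ (k ≠ k₀ → x ∉ A) := by
    intro k A hA
    by_cases hk : k = k₀
    · simp only [H, if_pos hk, Finset.mem_union, Finset.mem_image] at hA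
      refine ⟨?_, fun h => absurd hk h⟩
      rcases hA with hA | ⟨B, hB, rfl⟩
      · rwa [Finset.erase_eq_of_notMem (hx k A hA)]
      · rwa [Finset.erase_insert (hx k B hB)]
    · simp only [H, if_neg hk] at hA
      exact ⟨by rwa [Finset.erase_eq_of_notMem (hx k A hA)], fun _ => hx k A hA⟩
  have hov : Overlap m H := by
    intro i j hij A hA B hB
    refine (Finset.card_le_card fun y hy => ?_).trans
      (hG i j hij _ (hH i A hA).1 _ (hH j B hB).1)
    obtain ⟨hyA, hyB⟩ := Finset.mem_inter.1 hy
    have hyx : y ≠ x := by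
      rintro rfl
      by_cases hi : i = k₀
      · exact (hH j B hB).2 (fun hj => hij (hi.trans hj.symm)) hyB
      · exact (hH i A hA).2 hi hyA
    simp [hyx, hyA, hyB]
  have hcard : ∀ k, (H k).card = (if k = k₀ then 2 else 1) * (G k).card := by
    intro k
    by_cases hk : k = k₀
    · simp only [H, if_pos hk]
      rw [Finset.card_union_of_disjoint, Finset.card_image_of_injOn, two_mul]
      · intro A hA B hB hAB
        rw [← Finset.erase_insert (hx k A hA), hAB, Finset.erase_insert (hx k B hB)]
      · refine Finset.disjoint_left.2 fun A hA hA' => ?_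
        obtain ⟨B, -, rfl⟩ := Finset.mem_image.1 hA'
        exact hx k _ hA (Finset.mem_insert_self x B)
    · simp [H, hk]
  have h := hF.2 H hov
  simpa only [hcard, Finset.prod_mul_distrib, Finset.prod_ite_eq', Finset.mem_univ, if_true]
    using h

/-- The number of pairs `i < j` of elements of `T`. -/
def numPairs {ℓ : ℕ} (T : Finset (Fin ℓ)) : ℕ :=
  pairSum (fun i j => if i ∈ T ∧ j ∈ T then 1 else 0)

theorem one_le_numPairs {ℓ : ℕ} {T : Finset (Fin ℓ)} (hT : 2 ≤ T.card) : 1 ≤ numPairs T := by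
  obtain ⟨i, hi, j, hj, hij⟩ := Finset.one_lt_card.1 hT
  wlog h : i < j generalizing i j
  · exact this j hj i hi hij.symm (lt_of_le_of_ne (not_lt.1 h) hij.symm)
  rw [numPairs, pairSum_eq]
  refine le_trans ?_ (Finset.single_le_sum (fun _ _ => Nat.zero_le _)
    (Finset.mem_filter.2 ⟨Finset.mem_univ (i, j), h⟩))
  simp [hi, hj]

theorem three_le_numPairs {ℓ : ℕ} {T : Finset (Fin ℓ)} (hT : 3 ≤ T.card) : 3 ≤ numPairs T := by
  obtain ⟨T', hT', hcard⟩ := Finset.exists_subset_card_eq hT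
  let e := T'.orderEmbOfFin hcard
  have he : ∀ a, e a ∈ T := fun a => hT' (Finset.orderEmbOfFin_mem T' hcard a)
  have h01 : e 0 < e 1 := e.strictMono (by decide)
  have h12 : e 1 < e 2 := e.strictMono (by decide)
  rw [numPairs, pairSum_eq]
  have hsub : ({(e 0, e 1), (e 0, e 2), (e 1, e 2)} : Finset (Fin ℓ × Fin ℓ)) ⊆
      Finset.univ.filter (fun p : Fin ℓ × Fin ℓ => p.1 < p.2) := by
    intro p hp
    simp only [Finset.mem_insert, Finset.mem_singleton] at hp
    rcases hp with rfl | rfl | rfl <;> simp [h01, h12, h01.trans h12]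
  refine le_trans ?_ (Finset.sum_le_sum_of_subset hsub)
  rw [Finset.sum_insert, Finset.sum_pair]
  · simp [he]
  · simp [h01.ne]
  · simp [h01.ne, h12.ne]

theorem Overlap.prod_card_slice_mul_le {n ℓ : ℕ} {m : Fin ℓ → Fin ℓ → ℕ}
    {F : Fin ℓ → Finset (Finset (Fin n))} (hF : Overlap m F) (x : Fin n) (T : Finset (Fin ℓ)) :
    (∏ k, (_root_.slice F x T k).card) * (n + 1) ^ numPairs T ≤
      2 ^ n * (n + 1) ^ pairSum m := by
  by_cases h : ∃ i ∈ T, ∃ j ∈ T, i ≠ j ∧ m i j = 0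
  · obtain ⟨i, hi, j, hj, hij, hm⟩ := h
    rw [hF.prod_card_slice_eq_zero hij hi hj hm, zero_mul]
    exact Nat.zero_le _
  · push Not at h
    have hsum : pairSum (fun i j => m i j - if i ∈ T ∧ j ∈ T then 1 else 0) + numPairs T =
        pairSum m := by
      rw [numPairs, pairSum_eq, pairSum_eq, pairSum_eq, ← Finset.sum_add_distrib]
      refine Finset.sum_congr rfl fun p hp => Nat.sub_add_cancel ?_
      split_ifs with hT
      · exact Nat.one_le_iff_ne_zero.2 (h _ hT.1 _ hT.2 (Finset.mem_filter.1 hp).2.ne)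
      · exact Nat.zero_le _
    rw [← hsum, pow_add, ← mul_assoc]
    exact Nat.mul_le_mul_right _ (hF.slice x T).prod_card_le

theorem deg_mem_unitInterval {n ℓ : ℕ} (F : Fin ℓ → Finset (Finset (Fin n))) (k : Fin ℓ)
    (S : Finset (Fin n)) : 0 ≤ deg F k S ∧ deg F k S ≤ 1 := by
  refine ⟨by unfold deg; positivity, div_le_one_of_le₀ ?_ (Nat.cast_nonneg _)⟩
  exact_mod_cast Finset.card_filter_le _ _

/-- The proportion of tuples `(A_1, …, A_ℓ)` for which `x ∈ A_k` exactly when `k ∈ T`, in terms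
of the degrees `d k`. -/
def pattern {ℓ : ℕ} (d : Fin ℓ → ℝ) (T : Finset (Fin ℓ)) : ℝ :=
  ∏ k, if k ∈ T then d k else 1 - d k

theorem pattern_mul_prod_card {n ℓ : ℕ} {F : Fin ℓ → Finset (Finset (Fin n))}
    (hF : ∀ k, 0 < (F k).card) (x : Fin n) (T : Finset (Fin ℓ)) :
    pattern (fun k => deg F k {x}) T * ∏ k, ((F k).card : ℝ) =
      ∏ k, ((slice F x T k).card : ℝ) := by
  rw [pattern, ← Finset.prod_mul_distrib]
  refine Finset.prod_congr rfl fun k _ => ?_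
  have hpos : ((F k).card : ℝ) ≠ 0 := by exact_mod_cast (hF k).ne'
  have hdeg : deg F k {x} * (F k).card = ((F k).filter (fun A => x ∈ A)).card := by
    rw [deg, div_mul_cancel₀ _ hpos]
    simp only [Finset.singleton_subset_iff]
  rw [card_slice]
  by_cases hk : k ∈ T
  · simpa [hk] using hdeg
  · have h := Finset.card_filter_add_card_filter_not (s := F k) (fun A => x ∈ A)
    have h' : (((F k).filter (fun A => x ∈ A)).card : ℝ) +
      ((F k).filter (fun A => x ∉ A)).card = (F k).card := by exact_mod_cast h
    simp only [hk, if_false, iff_false]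
    linarith

/-- The probability bounds on the incidence patterns of an element in an extremal tuple. -/
theorem eventually_pattern_le {ℓ : ℕ} (k₀ : Fin ℓ) {m : Fin ℓ → Fin ℓ → ℕ}
    (hsym : ∀ i j, m i j = m j i) :
    ∃ D : ℝ, 0 < D ∧ ∀ᶠ n : ℕ in Filter.atTop, ∀ F : Fin ℓ → Finset (Finset (Fin n)),
      Extremal m F → ∀ (x : Fin n) (T : Finset (Fin ℓ)),
        pattern (fun k => deg F k {x}) T ≤ 1 / 2 ∧
        pattern (fun k => deg F k {x}) T * (n : ℝ) ^ numPairs T ≤ D := by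
  obtain ⟨c, hc, hev⟩ := exists_large_overlap k₀ hsym
  refine ⟨2 ^ pairSum m / c, by positivity, ?_⟩
  filter_upwards [hev, Filter.eventually_ge_atTop 1] with n hn hn1 F hF x T
  obtain ⟨G, hG, hGcard⟩ := hn
  have hn1' : (1 : ℝ) ≤ n := by exact_mod_cast hn1
  have hlow : c * (2 ^ n * (n : ℝ) ^ pairSum m) ≤ ∏ k, ((F k).card : ℝ) :=
    hGcard.trans (by exact_mod_cast hF.2 G hG)
  have hP : 0 < ∏ k, ((F k).card : ℝ) := lt_of_lt_of_le (by positivity) hlow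
  have hpos : ∀ k, 0 < (F k).card := fun k => Nat.pos_of_ne_zero fun h =>
    hP.ne' (Finset.prod_eq_zero (Finset.mem_univ k) (by rw [h, Nat.cast_zero]))
  have heq := pattern_mul_prod_card hpos x T
  constructor
  · have hov : Overlap m (slice F x T) := fun i j hij A hA B hB =>
      (hF.1.slice x T i j hij A hA B hB).trans (Nat.sub_le _ _)
    have h := hF.two_mul_prod_card_le hov (x := x)
      (fun k A hA => by obtain ⟨B, -, -, rfl⟩ := mem_slice.1 hA; simp) k₀
    have h' : 2 * ∏ k, ((slice F x T k).card : ℝ) ≤ ∏ k, ((F k).card : ℝ) := by exact_mod_cast h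
    rw [← heq] at h'
    by_contra! hlt
    nlinarith
  · have h : (∏ k, ((slice F x T k).card : ℝ)) * ((n : ℝ) + 1) ^ numPairs T ≤
        2 ^ n * ((n : ℝ) + 1) ^ pairSum m := by exact_mod_cast hF.1.prod_card_slice_mul_le x T
    rw [le_div_iff₀ hc]
    refine le_of_mul_le_mul_right ?_ (show (0 : ℝ) < 2 ^ n * (n : ℝ) ^ pairSum m by positivity)
    have hnum : 0 ≤ pattern (fun k => deg F k {x}) T :=
      Finset.prod_nonneg fun k _ => by
        have := deg_mem_unitInterval F k {x}
        split_ifs <;> linarith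
    calc pattern (fun k => deg F k {x}) T * (n : ℝ) ^ numPairs T * c *
          (2 ^ n * (n : ℝ) ^ pairSum m)
        = pattern (fun k => deg F k {x}) T * (n : ℝ) ^ numPairs T *
          (c * (2 ^ n * (n : ℝ) ^ pairSum m)) := by ring
      _ ≤ pattern (fun k => deg F k {x}) T * (n : ℝ) ^ numPairs T *
          ∏ k, ((F k).card : ℝ) := by gcongr
      _ = (∏ k, ((slice F x T k).card : ℝ)) * (n : ℝ) ^ numPairs T := by rw [← heq]; ring
      _ ≤ (∏ k, ((slice F x T k).card : ℝ)) * ((n : ℝ) + 1) ^ numPairs T := by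
          gcongr; linarith
      _ ≤ 2 ^ n * ((n : ℝ) + 1) ^ pairSum m := h
      _ ≤ 2 ^ n * (2 * (n : ℝ)) ^ pairSum m := by gcongr; linarith
      _ = 2 ^ pairSum m * (2 ^ n * (n : ℝ) ^ pairSum m) := by ring

section pattern

variable {ℓ : ℕ} {d : Fin ℓ → ℝ}

/-- If every factor of a pattern is at least `1 / 2`, except that the factor at `k` is only at
least `η`, then the pattern is at least `η / 2 ^ ℓ`. -/
theorem le_pattern {η : ℝ} (hη : 0 ≤ η) {T : Finset (Fin ℓ)} (k : Fin ℓ)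
    (hk : η ≤ if k ∈ T then d k else 1 - d k)
    (h : ∀ i ≠ k, 1 / 2 ≤ if i ∈ T then d i else 1 - d i) :
    (1 / 2) ^ ℓ * η ≤ pattern d T := by
  have hprod : ∏ i : Fin ℓ, ((1 / 2 : ℝ) * if i = k then η else 1) = (1 / 2) ^ ℓ * η := by
    simp only [Finset.prod_mul_distrib, Finset.prod_const, Finset.card_univ, Fintype.card_fin,
      Finset.prod_ite_eq', Finset.mem_univ, if_true]
  rw [← hprod, pattern]
  refine Finset.prod_le_prod (fun i _ => by split_ifs <;> positivity) fun i _ => ?_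
  by_cases hi : i = k
  · subst hi
    simp only [if_true]
    linarith
  · simpa [hi] using h i hi

/-- If no pattern is more likely than `1 / 2` and patterns with at least two elements are
unlikely, then the degrees are small at all but one index, where the degree is bounded away from
`0`. -/
theorem exists_dominant (hℓ : 0 < ℓ) (hhalf : ∀ T, pattern d T ≤ 1 / 2)
    (hpair : ∀ T : Finset (Fin ℓ), 2 ≤ T.card → pattern d T < (1 / 2) ^ ℓ * (1 / (4 * ℓ))) :
    ∃ k, 1 / (4 * ℓ) ≤ d k ∧ ∀ i ≠ k, d i ≤ 1 / 2 := by
  have hℓ' : (1 : ℝ) ≤ ℓ := by exact_mod_cast hℓ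
  set η : ℝ := 1 / (4 * ℓ) with hη
  have hη0 : 0 < η := by positivity
  have hη1 : η ≤ 1 / 4 := by
    rw [hη]; gcongr; linarith
  have hηℓ : ℓ * η = 1 / 4 := by rw [hη]; field_simp
  set T : Finset (Fin ℓ) := Finset.univ.filter (fun k => 1 / 2 < d k) with hT
  have hmem : ∀ i, i ∈ T ↔ 1 / 2 < d i := fun i => by simp [hT]
  have hfactor : ∀ i, 1 / 2 ≤ if i ∈ T then d i else 1 - d i := fun i => by
    by_cases hi : 1 / 2 < d i
    · rw [if_pos (by rwa [hmem])]
      exact hi.le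
    · rw [if_neg (by rwa [hmem])]
      linarith
  obtain ⟨k, hk⟩ : ∃ k, (if k ∈ T then d k else 1 - d k) ≤ 1 - η := by
    by_contra! hcon
    have h₁ : (1 - η) ^ ℓ ≤ pattern d T := by
      have : ∏ _i : Fin ℓ, (1 - η) = (1 - η) ^ ℓ := by simp
      rw [← this, pattern]
      exact Finset.prod_le_prod (fun i _ => by linarith) fun i _ => (hcon i).le
    have h₂ := one_add_mul_le_pow (a := -η) (by linarith) ℓ
    have h₃ := hhalf T
    rw [← sub_eq_add_neg] at h₂
    linarith
  have hk' : η ≤ d k ∧ η ≤ 1 - d k := by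
    have := hfactor k
    split_ifs at hk this <;> constructor <;> linarith
  have hsmall : ∀ T' : Finset (Fin ℓ), (∀ i ≠ k, i ∈ T' ↔ i ∈ T) → T'.card ≤ 1 := by
    intro T' hT'
    by_contra! hcard
    refine (hpair T' hcard).not_ge (le_pattern hη0.le k ?_ fun i hi => ?_)
    · split_ifs
      exacts [hk'.1, hk'.2]
    · simpa only [hT' i hi] using hfactor i
  refine ⟨k, hk'.1, fun i hi => ?_⟩
  by_contra! hlt
  have hcard := hsmall (insert k T) fun j hj => by simp [hj]
  exact hi (Finset.card_le_one.1 hcard i (Finset.mem_insert_of_mem ((hmem i).2 hlt))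
    k (Finset.mem_insert_self k T))

/-- A lower bound for the pattern `{k, i, j}` when the degree is at least `η` at `k` and at most
`1 / 2` elsewhere. -/
theorem mul_le_pattern {η : ℝ} (hη : 0 ≤ η) {k i j : Fin ℓ}
    (hik : i ≠ k) (hjk : j ≠ k) (hij : i ≠ j) (hd : ∀ k, 0 ≤ d k ∧ d k ≤ 1) (hk : η ≤ d k)
    (hhalf : ∀ i ≠ k, d i ≤ 1 / 2) :
    (1 / 2) ^ ℓ * η * (d i * d j) ≤ pattern d {k, i, j} := by
  have hprod : ∏ a : Fin ℓ, ((1 / 2 : ℝ) * (if a = k then η else 1) * (if a = i then d i else 1) *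
      if a = j then d j else 1) = (1 / 2) ^ ℓ * η * (d i * d j) := by
    simp only [Finset.prod_mul_distrib, Finset.prod_const, Finset.card_univ, Fintype.card_fin,
      Finset.prod_ite_eq', Finset.mem_univ, if_true, mul_assoc]
  rw [← hprod, pattern]
  have hi := hd i
  have hj := hd j
  refine Finset.prod_le_prod (fun a _ => ?_) fun a _ => ?_
  · have : (0 : ℝ) ≤ 1 / 2 := by norm_num
    refine mul_nonneg (mul_nonneg (mul_nonneg this ?_) ?_) ?_ <;> split_ifs <;>
      first | exact hη | exact hi.1 | exact hj.1 | exact zero_le_one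
  · by_cases hak : a = k
    · subst hak
      simp only [hik.symm, hjk.symm, if_true, if_false, Finset.mem_insert, true_or]
      linarith
    by_cases hai : a = i
    · subst hai
      simp only [hak, hij, if_true, if_false, Finset.mem_insert, true_or, or_true]
      linarith
    by_cases haj : a = j
    · subst haj
      simp only [hak, hai, if_true, if_false, Finset.mem_insert, Finset.mem_singleton, or_true]
      linarith
    · have := hhalf a hak
      simp only [hak, hai, haj, if_false, Finset.mem_insert, Finset.mem_singleton, or_self]
      linarith

end pattern

/-- In an extremal tuple every element has a family such that its degrees in any two of the other
families have product `O(n⁻³)`. -/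
theorem eventually_deg_mul_deg_le {ℓ : ℕ} (k₀ : Fin ℓ) {m : Fin ℓ → Fin ℓ → ℕ}
    (hsym : ∀ i j, m i j = m j i) :
    ∃ D : ℝ, 0 < D ∧ ∀ᶠ n : ℕ in Filter.atTop, ∀ F : Fin ℓ → Finset (Finset (Fin n)),
      Extremal m F → ∀ x : Fin n, ∃ k, ∀ i j, i ≠ k → j ≠ k → i ≠ j →
        deg F i {x} * deg F j {x} ≤ D / (n : ℝ) ^ 3 := by
  obtain ⟨D, hD, hev⟩ := eventually_pattern_le k₀ hsym
  have hℓ : 0 < ℓ := k₀.pos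
  set ε : ℝ := (1 / 2) ^ ℓ * (1 / (4 * ℓ)) with hε
  have hε0 : 0 < ε := by positivity
  have hlarge : ∀ᶠ n : ℕ in Filter.atTop, D / ε < n :=
    tendsto_natCast_atTop_atTop.eventually_gt_atTop _
  refine ⟨D / ε, by positivity, ?_⟩
  filter_upwards [hev, hlarge, Filter.eventually_ge_atTop 1] with n hn hnD hn1 F hF x
  have hn1' : (1 : ℝ) ≤ n := by exact_mod_cast hn1
  have hd : ∀ k, 0 ≤ deg F k {x} ∧ deg F k {x} ≤ 1 := fun k => deg_mem_unitInterval F k {x}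
  have hnonneg : ∀ T, 0 ≤ pattern (fun k => deg F k {x}) T := fun T =>
    Finset.prod_nonneg fun k _ => by
      have := hd k
      split_ifs <;> linarith
  have hbound : ∀ (T : Finset (Fin ℓ)) (e : ℕ), e ≤ numPairs T →
      pattern (fun k => deg F k {x}) T * (n : ℝ) ^ e ≤ D := fun T e he =>
    (mul_le_mul_of_nonneg_left (pow_le_pow_right₀ hn1' he) (hnonneg T)).trans (hn F hF x T).2
  obtain ⟨k, hk, hhalf⟩ := exists_dominant hℓ (fun T => (hn F hF x T).1) fun T hT => by
    have h := hbound T 1 (one_le_numPairs hT)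
    rw [div_lt_iff₀ hε0] at hnD
    rw [pow_one] at h
    by_contra! hcon
    nlinarith
  refine ⟨k, fun i j hik hjk hij => ?_⟩
  have h₁ := mul_le_pattern (by positivity) hik hjk hij hd hk hhalf
  have hcard : ({k, i, j} : Finset (Fin ℓ)).card = 3 :=
    Finset.card_eq_three.2 ⟨k, i, j, hik.symm, hjk.symm, hij, rfl⟩
  have h₂ := hbound {k, i, j} 3 (three_le_numPairs hcard.ge)
  rw [le_div_iff₀ (by positivity), le_div_iff₀ hε0]
  calc deg F i {x} * deg F j {x} * (n : ℝ) ^ 3 * ε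
      = ε * (deg F i {x} * deg F j {x}) * (n : ℝ) ^ 3 := by ring
    _ ≤ pattern (fun k => deg F k {x}) {k, i, j} * (n : ℝ) ^ 3 := by gcongr
    _ ≤ D := h₂

/-- element excluding, Lemma 8 of the paper. Fix `ℓ ≥ 2` and
symmetric `𝐦`. There are `C > 0` and `N` such that for every `n ≥ N` and extremal
`𝐦`-overlapping tuple `𝓕` on `[n]` there are subfamilies `𝓕'_k ⊆ 𝓕_k` with every
element of `[n]` lying in members of at most two of the `𝓕'_k`, and
`|𝓕'_k| ≥ (1 − C n^{-1/2})|𝓕_k|` for every `k`. -/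
theorem element_excluding (ℓ : ℕ) (hℓ : 2 ≤ ℓ) (m : Fin ℓ → Fin ℓ → ℕ)
    (hsym : ∀ k1 k2, m k1 k2 = m k2 k1) :
    ∃ C : ℝ, 0 < C ∧ ∃ N : ℕ, ∀ n : ℕ, N ≤ n →
      ∀ F : Fin ℓ → Finset (Finset (Fin n)), Extremal m F →
        ∃ F' : Fin ℓ → Finset (Finset (Fin n)),
          (∀ k, F' k ⊆ F k) ∧
          (∀ x : Fin n,
            ((Finset.univ : Finset (Fin ℓ)).filter (fun k => ∃ A ∈ F' k, x ∈ A)).card ≤ 2) ∧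
          (∀ k, (1 - C / Real.sqrt n) * ((F k).card : ℝ) ≤ ((F' k).card : ℝ)) := by
  obtain ⟨D, hD, hev⟩ := eventually_deg_mul_deg_le (⟨0, by omega⟩ : Fin ℓ) hsym
  obtain ⟨N, hN⟩ := Filter.eventually_atTop.1 hev
  refine ⟨√D, Real.sqrt_pos.2 hD, N + 1, fun n hn F hF => ?_⟩
  have hn0 : (0 : ℝ) < n := by exact_mod_cast (by omega : 0 < n)
  have hsn : 0 < √(n : ℝ) := Real.sqrt_pos.2 hn0
  set τ : ℝ := √D / (n * √n) with hτ
  have hτ0 : 0 < τ := by positivity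
  have hτsq : D / (n : ℝ) ^ 3 = τ * τ := by
    rw [hτ, div_mul_div_comm, Real.mul_self_sqrt hD.le, mul_mul_mul_comm,
      Real.mul_self_sqrt hn0.le]
    ring
  refine ⟨fun k => (F k).filter (fun A => ∀ x ∈ A, τ < deg F k {x}),
    fun k => Finset.filter_subset _ _, fun x => ?_, fun k => ?_⟩
  · obtain ⟨k, hk⟩ := hN n (by omega) F hF x
    set S := (Finset.univ : Finset (Fin ℓ)).filter
      (fun k => ∃ A ∈ (F k).filter (fun A => ∀ x ∈ A, τ < deg F k {x}), x ∈ A) with hS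
    have hSdeg : ∀ i ∈ S, τ < deg F i {x} := fun i hi => by
      obtain ⟨A, hA, hxA⟩ := (Finset.mem_filter.1 hi).2
      exact (Finset.mem_filter.1 hA).2 x hxA
    have herase : (S.erase k).card ≤ 1 := by
      refine Finset.card_le_one.2 fun i hi j hj => ?_
      by_contra hij
      have hi' := Finset.mem_erase.1 hi
      have hj' := Finset.mem_erase.1 hj
      have h := hk i j hi'.1 hj'.1 hij
      rw [hτsq] at h
      exact (mul_lt_mul'' (hSdeg i hi'.2) (hSdeg j hj'.2) hτ0.le hτ0.le).not_ge h
    have := Finset.pred_card_le_card_erase (s := S) (a := k)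
    omega
  · set low := (Finset.univ : Finset (Fin n)).filter (fun x => deg F k {x} ≤ τ) with hlow
    have hcover : (F k).filter (fun A => ¬ ∀ x ∈ A, τ < deg F k {x}) ⊆
        low.biUnion (fun x => (F k).filter (fun A => {x} ⊆ A)) := by
      intro A hA
      obtain ⟨hA, hx⟩ := Finset.mem_filter.1 hA
      push Not at hx
      obtain ⟨x, hxA, hx⟩ := hx
      exact Finset.mem_biUnion.2 ⟨x, by simpa [hlow] using hx, by simp [hA, hxA]⟩
    have hdeg : ∀ x ∈ low, (((F k).filter (fun A => {x} ⊆ A)).card : ℝ) ≤ τ * (F k).card := by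
      intro x hx
      have hx := (Finset.mem_filter.1 hx).2
      rcases (F k).eq_empty_or_nonempty with h | h
      · simp [h]
      · rwa [deg, div_le_iff₀ (by exact_mod_cast h.card_pos)] at hx
    have hlost : (((F k).filter (fun A => ¬ ∀ x ∈ A, τ < deg F k {x})).card : ℝ) ≤
        √D / √n * (F k).card := by
      calc (((F k).filter (fun A => ¬ ∀ x ∈ A, τ < deg F k {x})).card : ℝ)
          ≤ ∑ x ∈ low, (((F k).filter (fun A => {x} ⊆ A)).card : ℝ) := by
            exact_mod_cast (Finset.card_le_card hcover).trans Finset.card_biUnion_le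
        _ ≤ ∑ _x ∈ low, τ * (F k).card := Finset.sum_le_sum hdeg
        _ = low.card * (τ * (F k).card) := by rw [Finset.sum_const, nsmul_eq_mul]
        _ ≤ n * (τ * (F k).card) := by
            gcongr
            simpa using Finset.card_le_univ low
        _ = √D / √n * (F k).card := by
            rw [hτ]
            field_simp
    have hsplit := Finset.card_filter_add_card_filter_not (s := F k)
      (fun A => ∀ x ∈ A, τ < deg F k {x})
    have hsplit' : (((F k).filter (fun A => ∀ x ∈ A, τ < deg F k {x})).card : ℝ) +
        ((F k).filter (fun A => ¬ ∀ x ∈ A, τ < deg F k {x})).card = (F k).card := by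
      exact_mod_cast hsplit
    linarith

end
end

section
/- For every tournament T on 5 vertices, the number r(T) of unordered pairs of distinct vertices possessing a common in-neighbor is at most 7; moreover, there exists a tournament on 5 vertices with r(T) = 7. -/
/-- A tournament on `Fin ℓ`, given by an arc function: no loops, and for distinct
vertices exactly one of the two arcs is present. -/
def IsTournament {ℓ : ℕ} (E : Fin ℓ → Fin ℓ → Bool) : Prop :=
  (∀ u, E u u = false) ∧ ∀ u v : Fin ℓ, u ≠ v → (E u v = true ↔ E v u = false)

/-- `r(T)`: the number of unordered pairs of distinct vertices having a common
in-neighbor. -/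
def commonInNbrPairs {ℓ : ℕ} (E : Fin ℓ → Fin ℓ → Bool) : ℕ :=
  ((Finset.univ : Finset (Fin ℓ × Fin ℓ)).filter
    (fun p => p.1 < p.2 ∧ ∃ w, E w p.1 = true ∧ E w p.2 = true)).card

/-- The number of pairs with a common in-neighbor as a sum of indicators over the ten pairs. -/
theorem commonInNbrPairs_five (E : Fin 5 → Fin 5 → Bool) :
    commonInNbrPairs E =
      ∑ u : Fin 5, ∑ v : Fin 5,
        (decide (u < v) && (E 0 u && E 0 v || E 1 u && E 1 v || E 2 u && E 2 v ||
          E 3 u && E 3 v || E 4 u && E 4 v)).toNat := by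
  rw [commonInNbrPairs, Finset.card_filter, Fintype.sum_prod_type]
  refine Finset.sum_congr rfl fun u _ => Finset.sum_congr rfl fun v _ => ?_
  rw [Bool.toNat, Bool.cond_eq_ite]
  simp [Fin.exists_fin_succ, or_assoc]

theorem IsTournament.arc_eq_not {ℓ : ℕ} {E : Fin ℓ → Fin ℓ → Bool} (h : IsTournament E)
    {u v : Fin ℓ} (huv : u ≠ v) : E u v = !E v u := by
  have := h.2 u v huv
  cases hu : E u v <;> cases hv : E v u <;> simp_all

/-- Every tournament on 5 vertices has at most 7 pairs of distinct
vertices with a common in-neighbor, and some tournament on 5 vertices attains 7. -/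
theorem tournament_five :
    (∀ E : Fin 5 → Fin 5 → Bool, IsTournament E → commonInNbrPairs E ≤ 7) ∧
    (∃ E : Fin 5 → Fin 5 → Bool, IsTournament E ∧ commonInNbrPairs E = 7) := by
  constructor
  · intro E h
    rw [commonInNbrPairs_five]
    simp only [Fin.sum_univ_five, h.1,
      h.arc_eq_not (show (1 : Fin 5) ≠ 0 by decide), h.arc_eq_not (show (2 : Fin 5) ≠ 0 by decide),
      h.arc_eq_not (show (3 : Fin 5) ≠ 0 by decide), h.arc_eq_not (show (4 : Fin 5) ≠ 0 by decide),
      h.arc_eq_not (show (2 : Fin 5) ≠ 1 by decide), h.arc_eq_not (show (3 : Fin 5) ≠ 1 by decide),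
      h.arc_eq_not (show (4 : Fin 5) ≠ 1 by decide), h.arc_eq_not (show (3 : Fin 5) ≠ 2 by decide),
      h.arc_eq_not (show (4 : Fin 5) ≠ 2 by decide), h.arc_eq_not (show (4 : Fin 5) ≠ 3 by decide)]
    generalize E 0 1 = a, E 0 2 = b, E 0 3 = c, E 0 4 = d, E 1 2 = e, E 1 3 = f, E 1 4 = g,
      E 2 3 = i, E 2 4 = j, E 3 4 = k
    clear h
    revert a b c d e f g i j k
    decide +kernel
  · refine ⟨fun u v => decide ((u, v) ∈ ([(0, 1), (1, 2), (2, 0), (0, 3), (1, 3), (2, 3), (0, 4),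
      (1, 4), (2, 4), (3, 4)] : List (Fin 5 × Fin 5))), ⟨by decide, by decide⟩, ?_⟩
    rw [commonInNbrPairs_five]
    decide +kernel
end
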